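/- arXiv:2404.17256 — 2 statements merged into one kernel-verified Lean document; each statement's English description precedes it below -/
import Mathlib

section
/- Let G be a finite abelian group, k a field whose characteristic does not divide |G|, and χ₁,…,χ_N : G → kˣ characters with χ_{N−1} = χ_N. Let V be the diagonal representation given by χ₁,…,χ_N and V' the one given by χ₁,…,χ_{N−1}. Then β^r(G,V) = β^r(G,V') and γ^r(G,V) = γ^r(G,V'). -/
open MvPolynomial

noncomputable section

variable {k : Type} [Field k] {N : ℕ} {G : Type}

def mAct (M : Matrix (Fin N) (Fin N) k) :
    MvPolynomial (Fin N) k →ₐ[k] MvPolynomial (Fin N) k :=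
  aeval fun i => ∑ j, C (M i j) * X j

lemma mAct_comp (A B : Matrix (Fin N) (Fin N) k) :
    (mAct A).comp (mAct B) = mAct (B * A) := by
  apply MvPolynomial.algHom_ext
  intro i
  simp only [mAct, AlgHom.comp_apply, aeval_X, map_sum, map_mul, aeval_C, algebraMap_eq,
    Finset.mul_sum, Matrix.mul_apply, Finset.sum_mul]
  rw [Finset.sum_comm]
  simp [mul_assoc]

lemma mAct_one : mAct (1 : Matrix (Fin N) (Fin N) k) = AlgHom.id k _ := by
  apply MvPolynomial.algHom_ext
  intro i
  simp [mAct, Matrix.one_apply, ite_mul, apply_ite C]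

def mEquiv (M : GL (Fin N) k) :
    MvPolynomial (Fin N) k ≃ₐ[k] MvPolynomial (Fin N) k :=
  AlgEquiv.ofAlgHom (mAct (M : Matrix (Fin N) (Fin N) k))
    (mAct ((M⁻¹ : GL (Fin N) k) : Matrix (Fin N) (Fin N) k))
    (by rw [mAct_comp, Units.inv_mul, mAct_one])
    (by rw [mAct_comp, Units.mul_inv, mAct_one])

def fAct (M : GL (Fin N) k) :
    FractionRing (MvPolynomial (Fin N) k) ≃+* FractionRing (MvPolynomial (Fin N) k) :=
  IsFractionRing.ringEquivOfRingEquiv (mEquiv M).toRingEquiv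

/-- `f` is an invariant rational function for the linear action `ρ`. -/
def IsInv (ρ : G → GL (Fin N) k) (f : FractionRing (MvPolynomial (Fin N) k)) : Prop :=
  ∀ g, fAct (ρ g) f = f

/-- `f`, written as a quotient `f₁/f₂` of coprime polynomials, has
`deg f = deg f₁ + deg f₂ ≤ d`. -/
def RDegLE (f : FractionRing (MvPolynomial (Fin N) k)) (d : ℕ) : Prop :=
  ∃ f₁ f₂ : MvPolynomial (Fin N) k, f₂ ≠ 0 ∧
    (∀ p : MvPolynomial (Fin N) k, p ∣ f₁ → p ∣ f₂ → IsUnit p) ∧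
    f = algebraMap (MvPolynomial (Fin N) k) (FractionRing (MvPolynomial (Fin N) k)) f₁ /
        algebraMap (MvPolynomial (Fin N) k) (FractionRing (MvPolynomial (Fin N) k)) f₂ ∧
    f₁.totalDegree + f₂.totalDegree ≤ d

/-- `f` is (the image in `k(V)` of) a polynomial of degree at most `d`. -/
def PDegLE (f : FractionRing (MvPolynomial (Fin N) k)) (d : ℕ) : Prop :=
  ∃ p : MvPolynomial (Fin N) k, p.totalDegree ≤ d ∧
    f = algebraMap (MvPolynomial (Fin N) k) (FractionRing (MvPolynomial (Fin N) k)) p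

/-- `β^r(G,V)`: the least `d` such that the invariant rational functions of degree at most `d`
generate the invariant field over `k`. -/
def betaR (ρ : G → GL (Fin N) k) : ℕ :=
  sInf {d : ℕ | ∀ f, IsInv ρ f →
    f ∈ IntermediateField.adjoin k {h | IsInv ρ h ∧ RDegLE h d}}

/-- `β(G,V)`: the least `d` such that the invariant polynomials of degree at most `d`
generate the invariant field over `k`. -/
def betaP (ρ : G → GL (Fin N) k) : ℕ :=
  sInf {d : ℕ | ∀ f, IsInv ρ f →
    f ∈ IntermediateField.adjoin k {h | IsInv ρ h ∧ PDegLE h d}}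

/-- `γ^r(G,V)`: the least `d` such that the invariant rational functions of degree at most `d`
contain a transcendence basis for the invariant field over `k`. -/
def gammaR (ρ : G → GL (Fin N) k) : ℕ :=
  sInf {d : ℕ | ∃ s : Set (FractionRing (MvPolynomial (Fin N) k)),
    (∀ f ∈ s, IsInv ρ f ∧ RDegLE f d) ∧
    AlgebraicIndependent k ((↑) : s → FractionRing (MvPolynomial (Fin N) k)) ∧
    ∀ f, IsInv ρ f → IsAlgebraic (IntermediateField.adjoin k s) f}

/-- `γ(G,V)`: the least `d` such that the invariant polynomials of degree at most `d`
contain a transcendence basis for the invariant field over `k`. -/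
def gammaP (ρ : G → GL (Fin N) k) : ℕ :=
  sInf {d : ℕ | ∃ s : Set (FractionRing (MvPolynomial (Fin N) k)),
    (∀ f ∈ s, IsInv ρ f ∧ PDegLE f d) ∧
    AlgebraicIndependent k ((↑) : s → FractionRing (MvPolynomial (Fin N) k)) ∧
    ∀ f, IsInv ρ f → IsAlgebraic (IntermediateField.adjoin k s) f}

variable [CommGroup G]

/-- The invertible diagonal matrix with units `c i` on the diagonal. -/
def diagGL (c : Fin N → kˣ) : GL (Fin N) k :=
  ⟨Matrix.diagonal fun i => (c i : k), Matrix.diagonal fun i => ((c i)⁻¹ : kˣ),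
   by simp [Matrix.diagonal_mul_diagonal], by simp [Matrix.diagonal_mul_diagonal]⟩

/-- The diagonal linear action of `G` attached to a tuple of characters `χ i : G →* kˣ`:
`g` acts by scaling the `i`-th coordinate by `χ i g`. -/
def diagρ (χ : Fin N → (G →* kˣ)) : G → GL (Fin N) k :=
  fun g => diagGL fun i => χ i g

/-- The exponent vector `a ∈ ℤᴺ` lies in the lattice `L(G,V)` of exponent vectors of
`G`-invariant Laurent monomials. -/
def inLat (χ : Fin N → (G →* kˣ)) (a : Fin N → ℤ) : Prop :=
  ∀ g, ∏ i, (χ i g) ^ (a i) = 1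

/-- The degree (`L¹`-norm) of an exponent vector. -/
def degZ (a : Fin N → ℤ) : ℕ := ∑ i, (a i).natAbs

/-- The Laurent monomial `x^a ∈ k(x₁,…,x_N)` with exponent vector `a : Fin N → ℤ`. -/
def laur (a : Fin N → ℤ) : FractionRing (MvPolynomial (Fin N) k) :=
  ∏ i, (algebraMap (MvPolynomial (Fin N) k) (FractionRing (MvPolynomial (Fin N) k)) (X i)) ^ (a i)

/-- The lattice `L(G,V)` as an additive subgroup of `ℤᴺ`. -/
def latgrp (χ : Fin N → (G →* kˣ)) : AddSubgroup (Fin N → ℤ) where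
  carrier := {a | inLat χ a}
  zero_mem' := by intro g; simp
  add_mem' := by
    intro a b ha hb g
    simp only [Pi.add_apply, zpow_add]
    rw [Finset.prod_mul_distrib, ha g, hb g, mul_one]
  neg_mem' := by
    intro a ha g
    simp only [Pi.neg_apply, zpow_neg]
    rw [Finset.prod_inv_distrib, ha g, inv_one]

/-! ### Laurent monomials -/

abbrev RF (N : ℕ) (k : Type) [Field k] : Type := FractionRing (MvPolynomial (Fin N) k)

lemma algX_ne (i : Fin N) :
    algebraMap (MvPolynomial (Fin N) k) (RF N k) (X i) ≠ 0 := by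
  intro h
  exact X_ne_zero (R := k) i
    ((map_eq_zero_iff _ (IsFractionRing.injective (MvPolynomial (Fin N) k) (RF N k))).1 h)

lemma laur_zero : laur (0 : Fin N → ℤ) = (1 : RF N k) := by simp [laur]

lemma laur_add (a b : Fin N → ℤ) : (laur (a + b) : RF N k) = laur a * laur b := by
  simp only [laur, Pi.add_apply]
  rw [← Finset.prod_mul_distrib]
  exact Finset.prod_congr rfl fun i _ => zpow_add₀ (algX_ne i) _ _

lemma laur_ne (a : Fin N → ℤ) : (laur a : RF N k) ≠ 0 :=
  Finset.prod_ne_zero_iff.2 fun i _ => zpow_ne_zero _ (algX_ne i)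

lemma laur_neg (a : Fin N → ℤ) : (laur (-a) : RF N k) = (laur a)⁻¹ := by
  apply eq_inv_of_mul_eq_one_left
  rw [← laur_add, neg_add_cancel, laur_zero]

lemma laur_sub (a b : Fin N → ℤ) : (laur (a - b) : RF N k) = laur a / laur b := by
  rw [sub_eq_add_neg, laur_add, laur_neg, div_eq_mul_inv]

lemma laur_nsmul (n : ℕ) (a : Fin N → ℤ) : (laur (n • a) : RF N k) = laur a ^ n := by
  induction n with
  | zero => simp [laur_zero]
  | succ n ih => rw [succ_nsmul, laur_add, ih, pow_succ]

lemma laur_cast (m : Fin N →₀ ℕ) :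
    (laur (fun i => (m i : ℤ)) : RF N k) =
      algebraMap (MvPolynomial (Fin N) k) (RF N k) (monomial m 1) := by
  rw [monomial_eq, Finsupp.prod_fintype _ _ (by simp)]
  simp [laur, map_prod, map_pow]

lemma smul_laur_cast (m : Fin N →₀ ℕ) (c : k) :
    c • (laur (fun i => (m i : ℤ)) : RF N k) =
      algebraMap (MvPolynomial (Fin N) k) (RF N k) (monomial m c) := by
  rw [laur_cast, Algebra.smul_def, IsScalarTower.algebraMap_apply k (MvPolynomial (Fin N) k),
    ← map_mul, MvPolynomial.algebraMap_eq, C_mul_monomial, mul_one]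

lemma laur_linInd : LinearIndependent k (laur : (Fin N → ℤ) → RF N k) := by
  rw [linearIndependent_iff']
  intro s c hs a ha
  set v : Fin N → ℤ := fun i => ∑ b ∈ s, |b i| with hv
  have hpos : ∀ b ∈ s, ∀ i, 0 ≤ b i + v i := by
    intro b hb i
    have h1 : |b i| ≤ v i := Finset.single_le_sum (f := fun b : Fin N → ℤ => |b i|)
      (fun _ _ => abs_nonneg _) hb
    have := neg_abs_le (b i)
    omega
  let e : (Fin N → ℤ) → (Fin N →₀ ℕ) := fun b =>
    Finsupp.equivFunOnFinite.symm fun i => (b i + v i).toNat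
  have he : ∀ b ∈ s, (laur (fun i => (e b i : ℤ)) : RF N k) = laur b * laur v := by
    intro b hb
    rw [← laur_add]
    congr 1
    funext i
    simp [e, Int.toNat_of_nonneg (hpos b hb i)]
  have hsum : algebraMap (MvPolynomial (Fin N) k) (RF N k)
      (∑ b ∈ s, monomial (e b) (c b)) = 0 := by
    rw [map_sum]
    have : ∀ b ∈ s, algebraMap (MvPolynomial (Fin N) k) (RF N k) (monomial (e b) (c b))
        = (c b • laur b) * laur v := by
      intro b hb
      rw [← smul_laur_cast, he b hb, smul_mul_assoc]
    rw [Finset.sum_congr rfl this, ← Finset.sum_mul, hs, zero_mul]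
  rw [map_eq_zero_iff _ (IsFractionRing.injective (MvPolynomial (Fin N) k) (RF N k))] at hsum
  have h2 := congrArg (coeff (e a)) hsum
  rw [coeff_sum, coeff_zero, Finset.sum_eq_single a] at h2
  · simpa using h2
  · intro b hb hba
    rw [coeff_monomial, if_neg]
    intro hE
    apply hba
    funext i
    have h3 := DFunLike.congr_fun hE i
    simp only [e, Finsupp.equivFunOnFinite_symm_apply_apply] at h3
    have := hpos a ha i
    have := hpos b hb i
    omega
  · intro h; exact absurd ha h

/-- elements of `k[M]` -/
lemma mem_adjoin_laur {S : Set (Fin N → ℤ)} {x : RF N k}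
    (hx : x ∈ Algebra.adjoin k (laur '' S)) :
    ∃ l : (Fin N → ℤ) →₀ k, (∀ a ∈ l.support, a ∈ AddSubgroup.closure S) ∧
      x = Finsupp.linearCombination k laur l := by
  have h1 : x ∈ Submodule.span k (laur '' (AddSubgroup.closure S : Set (Fin N → ℤ)) : Set (RF N k)) := by
    have h2 : x ∈ Subalgebra.toSubmodule (Algebra.adjoin k (laur '' S : Set (RF N k))) := hx
    rw [Algebra.adjoin_eq_span] at h2
    refine Submodule.span_mono ?_ h2
    intro y hy
    induction hy using Submonoid.closure_induction with
    | mem y hy =>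
      obtain ⟨a, ha, rfl⟩ := hy
      exact ⟨a, AddSubgroup.subset_closure ha, rfl⟩
    | one => exact ⟨0, AddSubgroup.zero_mem _, laur_zero⟩
    | mul y z _ _ hy hz =>
      obtain ⟨a, ha, rfl⟩ := hy
      obtain ⟨b, hb, rfl⟩ := hz
      exact ⟨a + b, AddSubgroup.add_mem _ ha hb, laur_add _ _⟩
  rw [Finsupp.mem_span_image_iff_linearCombination] at h1
  obtain ⟨l, hl, rfl⟩ := h1
  exact ⟨l, fun a ha => (Finsupp.mem_supported _ _).1 hl ha, rfl⟩

lemma lc_mul_laur (l : (Fin N → ℤ) →₀ k) (a : Fin N → ℤ) :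
    (Finsupp.linearCombination k laur l : RF N k) * laur a =
      Finsupp.linearCombination k laur (l.mapDomain (· + a)) := by
  rw [Finsupp.linearCombination_mapDomain, Finsupp.linearCombination_apply,
    Finsupp.linearCombination_apply, Finsupp.sum, Finsupp.sum, Finset.sum_mul]
  refine Finset.sum_congr rfl fun b _ => ?_
  simp [laur_add]

lemma shift_apply (l : (Fin N → ℤ) →₀ k) (a b : Fin N → ℤ) :
    l.mapDomain (· + a) b = l (b - a) := by
  have := Finsupp.mapDomain_apply (add_left_injective a) l (b - a)
  simpa using this

lemma mem_closure_of_laur_mem {S : Set (Fin N → ℤ)} {a : Fin N → ℤ}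
    (h : (laur a : RF N k) ∈ IntermediateField.adjoin k (laur '' S)) :
    a ∈ AddSubgroup.closure S := by
  obtain ⟨r, hr, s, hs, e⟩ := IntermediateField.mem_adjoin_iff_div.1 h
  have hs0 : s ≠ 0 := by
    rintro rfl
    simp at e
    exact laur_ne a e
  obtain ⟨lr, hlr, rfl⟩ := mem_adjoin_laur hr
  obtain ⟨ls, hls, rfl⟩ := mem_adjoin_laur hs
  have e2 : (Finsupp.linearCombination k laur ls : RF N k) * laur a =
      Finsupp.linearCombination k laur lr := by
    rw [e]; field_simp
  rw [lc_mul_laur] at e2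
  have e3 := laur_linInd e2
  have hls0 : ls ≠ 0 := by rintro rfl; simp at hs0
  obtain ⟨m, hm⟩ := Finsupp.support_nonempty_iff.2 hls0
  have hma : m + a ∈ lr.support := by
    rw [Finsupp.mem_support_iff, ← e3, shift_apply, add_sub_cancel_right]
    exact Finsupp.mem_support_iff.1 hm
  have := AddSubgroup.sub_mem _ (hlr _ hma) (hls _ hm)
  simpa using this

open scoped IntermediateField.algebraAdjoinAdjoin in
lemma exists_poly_of_isAlgebraic {E : Type} [Field E] [Algebra k E] {T : Set E} {x : E}
    (h : IsAlgebraic (IntermediateField.adjoin k T) x) :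
    ∃ p : Polynomial E, p ≠ 0 ∧ (∀ i, p.coeff i ∈ Algebra.adjoin k T) ∧ p.eval x = 0 := by
  have h' : IsAlgebraic (Algebra.adjoin k T) x :=
    (IsFractionRing.isAlgebraic_iff (Algebra.adjoin k T)
      (IntermediateField.adjoin k T) E).2 h
  obtain ⟨p, hp0, hp⟩ := h'
  have hinj : Function.Injective (algebraMap (Algebra.adjoin k T) E) := Subtype.val_injective
  refine ⟨p.map (algebraMap _ _), (Polynomial.map_ne_zero_iff hinj).2 hp0, fun i => ?_, ?_⟩
  · rw [Polynomial.coeff_map]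
    exact (p.coeff i).2
  · rwa [Polynomial.eval_map_algebraMap]

lemma nsmul_mem_closure_of_isAlgebraic {S : Set (Fin N → ℤ)} {a : Fin N → ℤ}
    (h : IsAlgebraic (IntermediateField.adjoin k (laur '' S : Set (RF N k))) (laur a : RF N k)) :
    ∃ n : ℕ, 0 < n ∧ n • a ∈ AddSubgroup.closure S := by
  obtain ⟨p, hp0, hpc, hp⟩ := exists_poly_of_isAlgebraic h
  by_contra! hcon
  have hdiff : ∀ i j : ℕ, ∀ m ∈ AddSubgroup.closure S, ∀ m' ∈ AddSubgroup.closure S,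
      m + i • a = m' + j • a → i = j := by
    have key : ∀ i j : ℕ, ∀ m ∈ AddSubgroup.closure S, ∀ m' ∈ AddSubgroup.closure S,
      m + i • a = m' + j • a → ¬ i < j := by
      intro i j m hm m' hm' he hij
      refine hcon (j - i) (by omega) ?_
      have : (j - i) • a = m - m' := by
        obtain ⟨t, rfl⟩ := Nat.exists_eq_add_of_lt hij
        have h1 : i + t + 1 - i = t + 1 := by omega
        rw [h1]
        rw [add_assoc, add_smul i (t+1) a] at he
        rw [eq_sub_iff_add_eq]
        have := congrArg (fun z => z - i • a) he
        simp only [add_sub_cancel_right] at this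
        rw [this]; abel
      rw [this]
      exact AddSubgroup.sub_mem _ hm hm'
    intro i j m hm m' hm' he
    have h1 := key i j m hm m' hm' he
    have h2 := key j i m' hm' m hm he.symm
    omega
  have hl : ∀ i : ℕ, ∃ l : (Fin N → ℤ) →₀ k,
      (∀ a ∈ l.support, a ∈ AddSubgroup.closure S) ∧
      p.coeff i = Finsupp.linearCombination k laur l :=
    fun i => mem_adjoin_laur (hpc i)
  choose l hlS hl using hl
  rw [Polynomial.eval_eq_sum_range] at hp
  have hterm : ∀ i, p.coeff i * (laur a : RF N k) ^ i =
      Finsupp.linearCombination k laur ((l i).mapDomain (· + i • a)) := by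
    intro i
    rw [← lc_mul_laur, ← hl, laur_nsmul]
  simp_rw [hterm] at hp
  rw [← map_sum, ← map_zero (Finsupp.linearCombination k (laur : (Fin N → ℤ) → RF N k))] at hp
  have hp2 := laur_linInd hp
  obtain ⟨j, hj⟩ := Polynomial.support_nonempty.2 hp0
  have hlj : l j ≠ 0 := by
    intro h0
    have := hl j
    rw [h0, map_zero] at this
    exact Polynomial.mem_support_iff.1 hj this
  obtain ⟨m, hm⟩ := Finsupp.support_nonempty_iff.2 hlj
  have h3 := DFunLike.congr_fun hp2 (m + j • a)
  rw [Finsupp.finsetSum_apply, Finset.sum_eq_single j] at h3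
  · rw [shift_apply, add_sub_cancel_right] at h3
    exact Finsupp.mem_support_iff.1 hm h3
  · intro i _ hij
    rw [shift_apply]
    by_contra h4
    have h5 := hlS i _ (Finsupp.mem_support_iff.2 h4)
    exact hij (hdiff i j _ h5 _ (hlS j m hm) (by abel))
  · intro h4
    exact absurd (Finset.mem_range.2 (Nat.lt_succ_of_le (Polynomial.le_natDegree_of_mem_supp j hj))) h4

/-! ### The action -/

lemma fAct_alg (M : GL (Fin N) k) (p : MvPolynomial (Fin N) k) :
    fAct M (algebraMap _ (RF N k) p) = algebraMap _ (RF N k) (mAct (M : Matrix _ _ k) p) :=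
  IsFractionRing.ringEquivOfRingEquiv_algebraMap _ _

lemma mAct_diag_X (c : Fin N → k) (i : Fin N) :
    mAct (Matrix.diagonal c) (X i) = C (c i) * X i := by
  simp only [mAct, aeval_X]
  rw [Finset.sum_eq_single i]
  · simp
  · intro j _ hj
    rw [Matrix.diagonal_apply_ne' _ hj]; simp
  · simp

lemma mAct_diag_monomial (c : Fin N → k) (n : Fin N →₀ ℕ) (r : k) :
    mAct (Matrix.diagonal c) (monomial n r) = monomial n ((∏ i, c i ^ n i) * r) := by
  rw [monomial_eq, monomial_eq, Finsupp.prod_fintype _ _ (by simp), map_mul, map_prod]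
  simp only [map_pow, mAct_diag_X, mul_pow, Finset.prod_mul_distrib, map_mul, map_prod]
  rw [show mAct (Matrix.diagonal c) (C r) = C r from (mAct (Matrix.diagonal c)).commutes r]
  ring

lemma mAct_diag_coeff (c : Fin N → k) (p : MvPolynomial (Fin N) k) (m : Fin N →₀ ℕ) :
    coeff m (mAct (Matrix.diagonal c) p) = (∏ i, c i ^ m i) * coeff m p := by
  induction p using MvPolynomial.induction_on' with
  | monomial n r =>
    rw [mAct_diag_monomial, coeff_monomial, coeff_monomial]
    split_ifs with h
    · rw [h]
    · simp
  | add p q hp hq => rw [map_add, coeff_add, coeff_add, hp, hq, mul_add]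

lemma mAct_diag_totalDegree (c : Fin N → kˣ) (p : MvPolynomial (Fin N) k) :
    (mAct (Matrix.diagonal fun i => (c i : k)) p).totalDegree = p.totalDegree := by
  have : (mAct (Matrix.diagonal fun i => (c i : k)) p).support = p.support := by
    ext m
    rw [mem_support_iff, mem_support_iff, mAct_diag_coeff]
    have : (∏ i, (c i : k) ^ m i) ≠ 0 :=
      Finset.prod_ne_zero_iff.2 fun i _ => pow_ne_zero _ (c i).ne_zero
    simp [this]
  unfold totalDegree
  rw [this]

lemma fAct_laur (c : Fin N → kˣ) (a : Fin N → ℤ) :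
    fAct (diagGL c) (laur a) = ((∏ i, c i ^ a i : kˣ) : k) • (laur a : RF N k) := by
  have hX : ∀ i, fAct (diagGL c) (algebraMap (MvPolynomial (Fin N) k) (RF N k) (X i)) =
      algebraMap k (RF N k) (c i) * algebraMap (MvPolynomial (Fin N) k) (RF N k) (X i) := by
    intro i
    rw [fAct_alg]
    change algebraMap _ (RF N k) (mAct (Matrix.diagonal fun i => (c i : k)) (X i)) = _
    rw [mAct_diag_X, map_mul, ← MvPolynomial.algebraMap_eq, ← IsScalarTower.algebraMap_apply]
  simp only [laur, map_prod, map_zpow₀, hX, mul_zpow, Finset.prod_mul_distrib]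
  rw [Algebra.smul_def]
  congr 1
  rw [Units.coe_prod, map_prod]
  refine Finset.prod_congr rfl fun i _ => ?_
  rw [Units.val_zpow_eq_zpow_val, map_zpow₀]

lemma isInv_laur {χ : Fin N → (G →* kˣ)} {a : Fin N → ℤ} (ha : inLat χ a) :
    IsInv (diagρ χ) (laur a : RF N k) := by
  intro g
  rw [diagρ, fAct_laur, ha g]
  simp

lemma totalDegree_prod_le (e : Fin N → ℕ) :
    (∏ i, (X i : MvPolynomial (Fin N) k) ^ e i).totalDegree ≤ ∑ i, e i := by
  refine (totalDegree_finsetProd _ _).trans (Finset.sum_le_sum fun i _ => ?_)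
  rw [totalDegree_X_pow]

lemma rdeg_laur {a : Fin N → ℤ} {d : ℕ} (ha : degZ a ≤ d) : RDegLE (laur a : RF N k) d := by
  refine ⟨∏ i, X i ^ (a i).toNat, ∏ i, X i ^ (-a i).toNat, ?_, ?_, ?_, ?_⟩
  · exact Finset.prod_ne_zero_iff.2 fun i _ => pow_ne_zero _ (X_ne_zero i)
  · suffices IsRelPrime (∏ i, (X i : MvPolynomial (Fin N) k) ^ (a i).toNat)
        (∏ i, X i ^ (-a i).toNat) from fun p h1 h2 => this h1 h2
    refine IsRelPrime.prod_left fun i _ => IsRelPrime.prod_right fun j _ => ?_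
    by_cases hij : i = j
    · subst hij
      rcases le_total 0 (a i) with h | h
      · rw [show (-a i).toNat = 0 by omega, pow_zero]; exact isRelPrime_one_right
      · rw [show (a i).toNat = 0 by omega, pow_zero]; exact isRelPrime_one_left
    · refine IsRelPrime.pow_left (IsRelPrime.pow_right ?_)
      rw [(X_prime (R := k) (i := i)).irreducible.isRelPrime_iff_not_dvd, X_dvd_X]
      exact hij
  · simp only [map_prod, map_pow, laur]
    rw [← Finset.prod_div_distrib]
    refine Finset.prod_congr rfl fun i _ => ?_
    rw [← zpow_natCast, ← zpow_natCast, ← zpow_sub₀ (algX_ne i)]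
    congr 1
    omega
  · refine (add_le_add (totalDegree_prod_le _) (totalDegree_prod_le _)).trans (le_trans ?_ ha)
    rw [← Finset.sum_add_distrib, degZ]
    exact Finset.sum_le_sum fun i _ => by omega

/-- Exponent vectors of invariant Laurent monomials of degree at most `d`. -/
def latLE (χ : Fin N → (G →* kˣ)) (d : ℕ) : Set (Fin N → ℤ) := {a | inLat χ a ∧ degZ a ≤ d}

lemma inv_coeff {χ : Fin N → (G →* kˣ)} {f₁ f₂ : MvPolynomial (Fin N) k} (h₁ : f₁ ≠ 0) (h₂ : f₂ ≠ 0)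
    (hcop : IsRelPrime f₁ f₂)
    (hinv : IsInv (diagρ χ) (algebraMap _ (RF N k) f₁ / algebraMap _ (RF N k) f₂))
    {m n : Fin N →₀ ℕ} (hm : m ∈ f₁.support) (hn : n ∈ f₂.support) :
    inLat χ (fun i => (m i : ℤ) - n i) := by
  intro g
  have hinj := IsFractionRing.injective (MvPolynomial (Fin N) k) (RF N k)
  set D : MvPolynomial (Fin N) k →ₐ[k] MvPolynomial (Fin N) k :=
    mAct (Matrix.diagonal fun i => (χ i g : k)) with hD
  have hD0 : ∀ p : MvPolynomial (Fin N) k, p ≠ 0 → D p ≠ 0 := by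
    intro p hp h0
    obtain ⟨m, hm⟩ := support_nonempty.2 hp
    have := congrArg (coeff m) h0
    rw [mAct_diag_coeff, coeff_zero] at this
    have h3 : (∏ i, (χ i g : k) ^ m i) ≠ 0 :=
      Finset.prod_ne_zero_iff.2 fun i _ => pow_ne_zero _ (χ i g).ne_zero
    exact (mul_ne_zero h3 (mem_support_iff.1 hm)) this
  have h := hinv g
  rw [map_div₀, fAct_alg, fAct_alg] at h
  change algebraMap _ (RF N k) (D f₁) / algebraMap _ (RF N k) (D f₂) = _ at h
  rw [div_eq_div_iff ((map_ne_zero_iff _ hinj).2 (hD0 _ h₂)) ((map_ne_zero_iff _ hinj).2 h₂),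
    ← map_mul, ← map_mul] at h
  have h := hinj h
  have hdvd : f₁ ∣ D f₁ := hcop.dvd_of_dvd_mul_right ⟨_, h⟩
  obtain ⟨q, hq⟩ := hdvd
  have hq0 : q ≠ 0 := by
    rintro rfl
    exact hD0 _ h₁ (by rw [hq, mul_zero])
  have hdeg := mAct_diag_totalDegree (fun i => χ i g) f₁
  rw [← hD, hq, totalDegree_mul_of_isDomain h₁ hq0] at hdeg
  have hqC : q = C (coeff 0 q) := totalDegree_eq_zero_iff_eq_C.1 (by omega)
  have hq2 : D f₂ = f₂ * q := by
    apply mul_left_cancel₀ h₁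
    rw [← h, hq]; ring
  have key : ∀ (f : MvPolynomial (Fin N) k) (m : Fin N →₀ ℕ), m ∈ f.support → D f = f * q →
      ∏ i, (χ i g : k) ^ m i = coeff 0 q := by
    intro f m hm hf
    have := congrArg (coeff m) hf
    rw [mAct_diag_coeff, hqC, mul_comm f, coeff_C_mul] at this
    exact mul_right_cancel₀ (mem_support_iff.1 hm) this
  have e1 := (key f₁ m hm hq).trans (key f₂ n hn hq2).symm
  simp only [zpow_sub, zpow_natCast]
  rw [Finset.prod_mul_distrib, Finset.prod_inv_distrib, mul_inv_eq_one]
  apply Units.ext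
  push_cast
  exact e1

lemma deg_sub_le {f₁ f₂ : MvPolynomial (Fin N) k}
    {m n : Fin N →₀ ℕ} (hm : m ∈ f₁.support) (hn : n ∈ f₂.support) :
    degZ (fun i => (m i : ℤ) - n i) ≤ f₁.totalDegree + f₂.totalDegree := by
  have h1 := le_totalDegree hm
  have h2 := le_totalDegree hn
  rw [Finsupp.sum_fintype _ _ (by simp)] at h1 h2
  refine le_trans ?_ (add_le_add h1 h2)
  rw [← Finset.sum_add_distrib, degZ]
  exact Finset.sum_le_sum fun i _ => by omega

lemma poly_eq_sum (f : MvPolynomial (Fin N) k) :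
    algebraMap _ (RF N k) f = ∑ m ∈ f.support, coeff m f • (laur (fun i => (m i : ℤ)) : RF N k) := by
  conv_lhs => rw [← support_sum_monomial_coeff f]
  rw [map_sum]
  exact Finset.sum_congr rfl fun m _ => (smul_laur_cast _ _).symm

lemma inv_mem_adjoin {χ : Fin N → (G →* kˣ)} {f : RF N k} {d : ℕ}
    (hinv : IsInv (diagρ χ) f) (hd : RDegLE f d) :
    f ∈ IntermediateField.adjoin k (laur '' latLE χ d : Set (RF N k)) := by
  obtain ⟨f₁, f₂, h₂, hcop, rfl, hdeg⟩ := hd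
  by_cases h₁ : f₁ = 0
  · subst h₁; rw [map_zero, zero_div]; exact zero_mem _
  set K := IntermediateField.adjoin k (laur '' latLE χ d : Set (RF N k)) with hK
  have hmem : ∀ m ∈ f₁.support, ∀ n ∈ f₂.support,
      (laur (fun i => (m i : ℤ)) / laur (fun i => (n i : ℤ)) : RF N k) ∈ K := by
    intro m hm n hn
    rw [← laur_sub]
    refine IntermediateField.subset_adjoin _ _ ⟨_, ⟨?_, ?_⟩, rfl⟩
    · exact inv_coeff h₁ h₂ (fun p h h' => hcop p h h') hinv hm hn
    · exact (deg_sub_le hm hn).trans hdeg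
  obtain ⟨m₀, hm₀⟩ := support_nonempty.2 h₁
  obtain ⟨n₀, hn₀⟩ := support_nonempty.2 h₂
  have e1 : algebraMap _ (RF N k) f₁ / laur (fun i => (n₀ i : ℤ)) ∈ K := by
    rw [poly_eq_sum, Finset.sum_div]
    refine sum_mem fun m hm => ?_
    rw [smul_div_assoc]
    exact K.smul_mem (hmem m hm n₀ hn₀)
  have e2 : algebraMap _ (RF N k) f₂ / laur (fun i => (n₀ i : ℤ)) ∈ K := by
    rw [poly_eq_sum, Finset.sum_div]
    refine sum_mem fun n hn => ?_
    rw [smul_div_assoc]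
    refine K.smul_mem ?_
    have := div_mem (hmem m₀ hm₀ n₀ hn₀) (hmem m₀ hm₀ n hn)
    rwa [div_div_div_cancel_left' _ _ (laur_ne _)] at this
  have := div_mem e1 e2
  rwa [div_div_div_cancel_right₀ (laur_ne _)] at this

lemma exists_rdeg (f : RF N k) : ∃ d, RDegLE f d := by
  obtain ⟨a, b, h, e⟩ := IsFractionRing.exists_reduced_fraction (A := MvPolynomial (Fin N) k) f
  refine ⟨_, a, b, nonZeroDivisors.ne_zero b.2, fun p h1 h2 => h h1 h2, ?_, le_rfl⟩
  rw [← e, IsFractionRing.mk'_eq_div]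

lemma inv_mem_adjoin' {χ : Fin N → (G →* kˣ)} {f : RF N k} (hinv : IsInv (diagρ χ) f) :
    f ∈ IntermediateField.adjoin k (laur '' {a | inLat χ a} : Set (RF N k)) := by
  obtain ⟨d, hd⟩ := exists_rdeg f
  refine IntermediateField.adjoin.mono k _ _ (Set.image_mono ?_) (inv_mem_adjoin hinv hd)
  exact fun a ha => ha.1

lemma laur_mem_of_closure {S : Set (Fin N → ℤ)} {K : IntermediateField k (RF N k)}
    (hS : ∀ a ∈ S, laur a ∈ K) {a : Fin N → ℤ} (ha : a ∈ AddSubgroup.closure S) : laur a ∈ K := by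
  induction ha using AddSubgroup.closure_induction with
  | mem a ha => exact hS a ha
  | zero => rw [laur_zero]; exact one_mem _
  | add a b _ _ ha hb => rw [laur_add]; exact mul_mem ha hb
  | neg a _ ha => rw [laur_neg]; exact inv_mem ha

lemma beta_iff (χ : Fin N → (G →* kˣ)) (d : ℕ) :
    (∀ f : RF N k, IsInv (diagρ χ) f →
      f ∈ IntermediateField.adjoin k {h : RF N k | IsInv (diagρ χ) h ∧ RDegLE h d}) ↔
    ∀ a, inLat χ a → a ∈ AddSubgroup.closure (latLE χ d) := by
  constructor
  · intro h a ha
    apply mem_closure_of_laur_mem (k := k)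
    refine IntermediateField.adjoin_le_iff.2 ?_ (h _ (isInv_laur ha))
    exact fun f hf => inv_mem_adjoin hf.1 hf.2
  · intro h f hf
    refine IntermediateField.adjoin_le_iff.2 ?_ (inv_mem_adjoin' hf)
    rintro _ ⟨a, ha, rfl⟩
    refine laur_mem_of_closure (fun b hb => ?_) (h a ha)
    exact IntermediateField.subset_adjoin _ _ ⟨isInv_laur hb.1, rdeg_laur hb.2⟩

/-! ### Transcendence bases -/

section generic

variable {E : Type} [Field E] [Algebra k E]

lemma isAlgebraic_mono {S T : IntermediateField k E} (h : S ≤ T) {x : E}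
    (hx : IsAlgebraic S x) : IsAlgebraic T x := by
  let _ := (IntermediateField.inclusion h).toRingHom.toAlgebra
  have : IsScalarTower S T E := IsScalarTower.of_algebraMap_eq fun _ => rfl
  exact hx.tower_top T

lemma exists_basis (t : Set E) : ∃ s ⊆ t, AlgebraicIndependent k ((↑) : s → E) ∧
    ∀ x ∈ t, IsAlgebraic (IntermediateField.adjoin k s) x := by
  obtain ⟨s, -, hs⟩ := exists_maximal_algebraicIndependent (R := k) (∅ : Set E) t
    (Set.empty_subset _) ((algebraicIndependent_empty_iff k E).2 (algebraMap k E).injective)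
  refine ⟨s, hs.prop.2, hs.prop.1, fun x hx => ?_⟩
  by_contra hcon
  have htr : Transcendental (Algebra.adjoin k (id '' s)) (id x) := by
    rw [Set.image_id]
    intro halg
    apply hcon
    let _ := (Subalgebra.inclusion (IntermediateField.algebra_adjoin_le_adjoin k s)).toRingHom.toAlgebra
    have : IsScalarTower (Algebra.adjoin k s) (IntermediateField.adjoin k s) E :=
      IsScalarTower.of_algebraMap_eq fun _ => rfl
    refine halg.extendScalars ?_
    exact Subalgebra.inclusion_injective (IntermediateField.algebra_adjoin_le_adjoin k s)
  have hins := hs.prop.1.insert htr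
  have := hs.le_of_ge ⟨hins, Set.insert_subset hx hs.prop.2⟩ (Set.subset_insert _ _)
  have hxs : x ∈ s := this (Set.mem_insert _ _)
  exact hcon (isAlgebraic_algebraMap
    (⟨x, IntermediateField.subset_adjoin k s hxs⟩ : IntermediateField.adjoin k s))

/-- the relative algebraic closure of `k(s)`. -/
def relCl (s : Set E) : IntermediateField k E :=
  (algebraicClosure (IntermediateField.adjoin k s) E).restrictScalars k

lemma mem_relCl {s : Set E} {x : E} :
    x ∈ relCl (k := k) s ↔ IsAlgebraic (IntermediateField.adjoin k s) x := by
  rw [relCl, IntermediateField.mem_restrictScalars, mem_algebraicClosure_iff]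

end generic

lemma gamma_iff (χ : Fin N → (G →* kˣ)) (d : ℕ) :
    (∃ s : Set (RF N k),
      (∀ f ∈ s, IsInv (diagρ χ) f ∧ RDegLE f d) ∧
      AlgebraicIndependent k ((↑) : s → RF N k) ∧
      ∀ f, IsInv (diagρ χ) f → IsAlgebraic (IntermediateField.adjoin k s) f) ↔
    ∀ a, inLat χ a → ∃ n : ℕ, 0 < n ∧ n • a ∈ AddSubgroup.closure (latLE χ d) := by
  constructor
  · rintro ⟨s, hs, -, h⟩ a ha
    apply nsmul_mem_closure_of_isAlgebraic (k := k)
    refine isAlgebraic_mono ?_ (h _ (isInv_laur ha))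
    exact IntermediateField.adjoin_le_iff.2 fun f hf => inv_mem_adjoin (hs f hf).1 (hs f hf).2
  · intro h
    obtain ⟨s, hst, hind, halg⟩ := exists_basis (k := k) (laur '' latLE χ d : Set (RF N k))
    refine ⟨s, fun f hf => ?_, hind, fun f hf => ?_⟩
    · obtain ⟨a, ha, rfl⟩ := hst hf
      exact ⟨isInv_laur ha.1, rdeg_laur ha.2⟩
    · rw [← mem_relCl]
      refine IntermediateField.adjoin_le_iff.2 ?_ (inv_mem_adjoin' hf)
      rintro _ ⟨a, ha, rfl⟩
      obtain ⟨n, hn, hna⟩ := h a ha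
      have h1 : laur (n • a) ∈ relCl (k := k) s :=
        laur_mem_of_closure (fun b hb => mem_relCl.2 (halg _ ⟨b, hb, rfl⟩)) hna
      rw [laur_nsmul, mem_relCl] at h1
      exact mem_relCl.2 (h1.of_pow hn)

/-! ### Merging two coordinates of the lattice -/

def piM (N : ℕ) : (Fin (N + 2) → ℤ) →+ (Fin (N + 1) → ℤ) where
  toFun a := fun i => a i.castSucc + if i = Fin.last N then a (Fin.last (N + 1)) else 0
  map_zero' := by funext i; simp
  map_add' a b := by
    funext i
    simp only [Pi.add_apply]
    split_ifs <;> ring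

def iotaM (N : ℕ) : (Fin (N + 1) → ℤ) →+ (Fin (N + 2) → ℤ) where
  toFun b := Fin.snoc (α := fun _ => ℤ) b 0
  map_zero' := by
    funext i
    refine Fin.lastCases ?_ (fun i => ?_) i <;> simp
  map_add' a b := by
    funext i
    refine Fin.lastCases ?_ (fun i => ?_) i <;> simp

def tM (N : ℕ) : Fin (N + 2) → ℤ :=
  Fin.snoc (α := fun _ => ℤ) (fun i : Fin (N + 1) => if i = Fin.last N then -1 else 0) 1

lemma piM_iotaM (b : Fin (N + 1) → ℤ) : piM N (iotaM N b) = b := by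
  funext i; simp [piM, iotaM]

lemma piM_tM : piM N (tM N) = 0 := by
  funext i
  simp only [piM, tM, AddMonoidHom.coe_mk, ZeroHom.coe_mk, Fin.snoc_castSucc, Fin.snoc_last,
    Pi.zero_apply]
  split_ifs <;> rfl

lemma decomp (a : Fin (N + 2) → ℤ) :
    a = iotaM N (piM N a) + a (Fin.last (N + 1)) • tM N := by
  funext i
  refine Fin.lastCases ?_ (fun i => ?_) i
  · simp [piM, iotaM, tM]
  · simp only [piM, iotaM, tM, AddMonoidHom.coe_mk, ZeroHom.coe_mk, Fin.snoc_castSucc,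
      Pi.add_apply, Pi.smul_apply, smul_eq_mul]
    split_ifs <;> ring

lemma degZ_piM (a : Fin (N + 2) → ℤ) : degZ (piM N a) ≤ degZ a := by
  unfold degZ
  rw [Fin.sum_univ_castSucc (n := N + 1)]
  have h : ∑ i : Fin (N + 1), (if i = Fin.last N then (a (Fin.last (N + 1))).natAbs else 0)
      = (a (Fin.last (N + 1))).natAbs := by simp
  rw [← h, ← Finset.sum_add_distrib]
  refine Finset.sum_le_sum fun i _ => ?_
  simp only [piM, AddMonoidHom.coe_mk, ZeroHom.coe_mk]
  split_ifs <;> omega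

lemma degZ_iotaM (b : Fin (N + 1) → ℤ) : degZ (iotaM N b) = degZ b := by
  unfold degZ
  rw [Fin.sum_univ_castSucc]
  simp [iotaM]

lemma degZ_tM : degZ (tM N) = 2 := by
  unfold degZ
  rw [Fin.sum_univ_castSucc]
  simp [tM, apply_ite Int.natAbs]

section merge

variable {χ : Fin (N + 2) → (G →* kˣ)}

lemma inLat_piM (hdup : χ (Fin.last (N + 1)) = χ ((Fin.last N).castSucc)) (a : Fin (N + 2) → ℤ) :
    inLat (fun i : Fin (N + 1) => χ i.castSucc) (piM N a) ↔ inLat χ a := by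
  unfold inLat
  refine forall_congr' fun g => ?_
  rw [Fin.prod_univ_castSucc (n := N + 1)]
  simp only [piM, AddMonoidHom.coe_mk, ZeroHom.coe_mk, zpow_add, Finset.prod_mul_distrib]
  have h : ∏ i : Fin (N + 1), χ i.castSucc g ^ (if i = Fin.last N then a (Fin.last (N + 1)) else 0)
      = χ (Fin.last (N + 1)) g ^ a (Fin.last (N + 1)) := by
    rw [Finset.prod_eq_single (Fin.last N), if_pos rfl, hdup]
    · intro i _ hi
      rw [if_neg hi, zpow_zero]
    · simp
  rw [h]

lemma piM_closure (hdup : χ (Fin.last (N + 1)) = χ ((Fin.last N).castSucc)) {d : ℕ}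
    {a : Fin (N + 2) → ℤ} (ha : a ∈ AddSubgroup.closure (latLE χ d)) :
    piM N a ∈ AddSubgroup.closure (latLE (fun i : Fin (N + 1) => χ i.castSucc) d) := by
  have h : AddSubgroup.closure (latLE χ d) ≤ (AddSubgroup.closure
      (latLE (fun i : Fin (N + 1) => χ i.castSucc) d)).comap (piM N) := by
    rw [AddSubgroup.closure_le]
    intro b hb
    exact AddSubgroup.subset_closure ⟨(inLat_piM hdup b).2 hb.1, (degZ_piM b).trans hb.2⟩
  exact h ha

lemma iotaM_latLE (hdup : χ (Fin.last (N + 1)) = χ ((Fin.last N).castSucc)) {d : ℕ}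
    {b : Fin (N + 1) → ℤ} (hb : b ∈ latLE (fun i : Fin (N + 1) => χ i.castSucc) d) :
    iotaM N b ∈ latLE χ d := by
  refine ⟨(inLat_piM hdup _).1 ?_, ?_⟩
  · rw [piM_iotaM]; exact hb.1
  · rw [degZ_iotaM]; exact hb.2

lemma iotaM_closure (hdup : χ (Fin.last (N + 1)) = χ ((Fin.last N).castSucc)) {d : ℕ}
    {b : Fin (N + 1) → ℤ}
    (hb : b ∈ AddSubgroup.closure (latLE (fun i : Fin (N + 1) => χ i.castSucc) d)) :
    iotaM N b ∈ AddSubgroup.closure (latLE χ d) := by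
  have h : AddSubgroup.closure (latLE (fun i : Fin (N + 1) => χ i.castSucc) d) ≤
      (AddSubgroup.closure (latLE χ d)).comap (iotaM N) := by
    rw [AddSubgroup.closure_le]
    intro b hb
    exact AddSubgroup.subset_closure (iotaM_latLE hdup hb)
  exact h hb

lemma tM_mem [Fintype G] (hdup : χ (Fin.last (N + 1)) = χ ((Fin.last N).castSucc)) {d : ℕ}
    (h : ∀ a, inLat (fun i : Fin (N + 1) => χ i.castSucc) a → ∃ n : ℕ, 0 < n ∧
      n • a ∈ AddSubgroup.closure (latLE (fun i : Fin (N + 1) => χ i.castSucc) d)) :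
    tM N ∈ AddSubgroup.closure (latLE χ d) := by
  have htL : inLat χ (tM N) := by
    rw [← inLat_piM hdup, piM_tM]
    intro g; simp
  by_cases hd : 2 ≤ d
  · exact AddSubgroup.subset_closure ⟨htL, degZ_tM.le.trans hd⟩
  obtain ⟨b, hb, hb0⟩ : ∃ b ∈ latLE (fun i : Fin (N + 1) => χ i.castSucc) d,
      b (Fin.last N) ≠ 0 := by
    by_contra! hcon
    obtain ⟨n, hn, hmem⟩ := h (Pi.single (Fin.last N) (Fintype.card G : ℤ)) (by
      intro g
      rw [Finset.prod_eq_single (Fin.last N)]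
      · rw [Pi.single_eq_same, zpow_natCast, ← map_pow, pow_card_eq_one, map_one]
      · intro i _ hi
        rw [Pi.single_eq_of_ne hi, zpow_zero]
      · simp)
    have hle : AddSubgroup.closure (latLE (fun i : Fin (N + 1) => χ i.castSucc) d) ≤
        (Pi.evalAddMonoidHom (fun _ : Fin (N + 1) => ℤ) (Fin.last N)).ker := by
      rw [AddSubgroup.closure_le]
      intro b hb
      exact hcon b hb
    have h2 := hle hmem
    rw [AddMonoidHom.mem_ker] at h2
    simp at h2
    omega
  have hsum : (b (Fin.last N)).natAbs + ∑ i : Fin N, (b i.castSucc).natAbs ≤ 1 := by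
    have := hb.2
    unfold degZ at this
    rw [Fin.sum_univ_castSucc] at this
    omega
  have hz : ∀ i : Fin N, b i.castSucc = 0 := by
    intro i
    have h1 : ∑ i : Fin N, (b i.castSucc).natAbs = 0 := by omega
    have := Finset.sum_eq_zero_iff.1 h1 i (Finset.mem_univ _)
    omega
  have hb1 : b (Fin.last N) = 1 ∨ b (Fin.last N) = -1 := by omega
  set c : Fin (N + 2) → ℤ := iotaM N b + b (Fin.last N) • tM N with hc
  have hcv : ∀ i : Fin (N + 1), c i.castSucc = 0 := by
    intro i
    refine Fin.lastCases ?_ (fun i => ?_) i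
    · simp [hc, iotaM, tM]
    · simp [hc, iotaM, tM, hz, (Fin.castSucc_lt_last i).ne]
  have hcl : c (Fin.last (N + 1)) = b (Fin.last N) := by simp [hc, iotaM, tM]
  have hcS : c ∈ latLE χ d := by
    refine ⟨?_, ?_⟩
    · rw [← inLat_piM hdup, hc, map_add, map_zsmul, piM_tM, piM_iotaM, smul_zero, add_zero]
      exact hb.1
    · have : degZ c = (b (Fin.last N)).natAbs := by
        unfold degZ
        rw [Fin.sum_univ_castSucc]
        simp [hcv, hcl]
      have h3 := hb.2
      unfold degZ at h3
      rw [Fin.sum_univ_castSucc] at h3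
      omega
  have h4 : b (Fin.last N) • tM N ∈ AddSubgroup.closure (latLE χ d) := by
    have := AddSubgroup.sub_mem _ (AddSubgroup.subset_closure hcS)
      (AddSubgroup.subset_closure (iotaM_latLE hdup hb))
    rwa [hc, add_sub_cancel_left] at this
  rcases hb1 with h5 | h5 <;> rw [h5] at h4
  · simpa using h4
  · simpa using h4

lemma betaSet [Fintype G] (hdup : χ (Fin.last (N + 1)) = χ ((Fin.last N).castSucc)) (d : ℕ) :
    (∀ a, inLat χ a → a ∈ AddSubgroup.closure (latLE χ d)) ↔
    ∀ a, inLat (fun i : Fin (N + 1) => χ i.castSucc) a →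
      a ∈ AddSubgroup.closure (latLE (fun i : Fin (N + 1) => χ i.castSucc) d) := by
  constructor
  · intro h b hb
    have := piM_closure hdup (h (iotaM N b) ((inLat_piM hdup _).1 (by rwa [piM_iotaM])))
    rwa [piM_iotaM] at this
  · intro h a ha
    have ht := tM_mem hdup (d := d) fun a ha => ⟨1, one_pos, by rw [one_smul]; exact h a ha⟩
    rw [decomp a]
    exact AddSubgroup.add_mem _ (iotaM_closure hdup (h _ ((inLat_piM hdup a).2 ha)))
      (AddSubgroup.zsmul_mem _ ht _)

lemma gammaSet [Fintype G] (hdup : χ (Fin.last (N + 1)) = χ ((Fin.last N).castSucc)) (d : ℕ) :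
    (∀ a, inLat χ a → ∃ n : ℕ, 0 < n ∧ n • a ∈ AddSubgroup.closure (latLE χ d)) ↔
    ∀ a, inLat (fun i : Fin (N + 1) => χ i.castSucc) a → ∃ n : ℕ, 0 < n ∧
      n • a ∈ AddSubgroup.closure (latLE (fun i : Fin (N + 1) => χ i.castSucc) d) := by
  constructor
  · intro h b hb
    obtain ⟨n, hn, h1⟩ := h (iotaM N b) ((inLat_piM hdup _).1 (by rwa [piM_iotaM]))
    have := piM_closure hdup h1
    rw [map_nsmul, piM_iotaM] at this
    exact ⟨n, hn, this⟩
  · intro h a ha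
    have ht := tM_mem hdup h
    obtain ⟨n, hn, h1⟩ := h _ ((inLat_piM hdup a).2 ha)
    refine ⟨n, hn, ?_⟩
    rw [decomp a, smul_add, ← map_nsmul]
    exact AddSubgroup.add_mem _ (iotaM_closure hdup h1)
      (AddSubgroup.nsmul_mem _ (AddSubgroup.zsmul_mem _ ht _) _)

end merge

/-- Merging a pair of identical characters in a diagonal representation of a
finite abelian group (in nonmodular characteristic) changes neither `β^r` nor `γ^r`. -/
theorem stmt9 {k : Type} [Field k] {N : ℕ} {G : Type} [CommGroup G] [Fintype G]
    (hchar : (Fintype.card G : k) ≠ 0) (χ : Fin (N + 2) → (G →* kˣ))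
    (hdup : χ (Fin.last (N + 1)) = χ ((Fin.last N).castSucc)) :
    betaR (diagρ χ) = betaR (diagρ fun i : Fin (N + 1) => χ i.castSucc) ∧
    gammaR (diagρ χ) = gammaR (diagρ fun i : Fin (N + 1) => χ i.castSucc) := by
  constructor
  · unfold betaR
    congr 1
    ext d
    exact (beta_iff χ d).trans ((betaSet hdup d).trans (beta_iff _ d).symm)
  · unfold gammaR
    congr 1
    ext d
    exact (gamma_iff χ d).trans ((gammaSet hdup d).trans (gamma_iff _ d).symm)
end
end

section
/- Let G be a finite abelian group, k a field whose characteristic does not divide |G|, and V a faithful finite-dimensional representation of G over k; let m be the number of distinct nontrivial characters χ : G → (k̄)ˣ whose eigenspace in the base change of V to an algebraic closure k̄ is nonzero. If equality γ^r(G,V)^m = |G| holds, then, writing d := γ^r(G,V): k contains d distinct d-th roots of unity, G is isomorphic to (ℤ/dℤ)^m, and the m distinct nontrivial characters occurring in V_{k̄} form a basis for the character group of G as a ℤ/dℤ-module. -/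
open MvPolynomial

noncomputable section

variable {k : Type} [Field k] {N : ℕ} {G : Type}

/-- The character `χ : G → Lˣ` occurs in the base change to `L` of the representation `ρ`,
i.e. its eigenspace in `L ⊗ V` is nonzero. -/
def Occurs {L : Type} [Field L] [Algebra k L] [Monoid G] (ρ : G → GL (Fin N) k)
    (χ : G →* Lˣ) : Prop :=
  ∃ v : Fin N → L, v ≠ 0 ∧
    ∀ g, ((ρ g : Matrix (Fin N) (Fin N) k).map (algebraMap k L)).mulVec v = (χ g : L) • v


lemma det_eq_case {m d : ℕ} (hd : 0 < d) (V : Matrix (Fin m) (Fin m) ℤ)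
    (hrow : ∀ i, ∑ j, (V i j).natAbs ≤ d) (hdet : d ^ m ≤ V.det.natAbs) (j : Fin m) :
    ∃ i, (∀ l, l ≠ j → V i l = 0) ∧ (V i j).natAbs = d := by
  classical
  have h1 : V.det.natAbs ≤ ∑ σ : Equiv.Perm (Fin m), ∏ i, (V i (σ i)).natAbs := by
    rw [← Matrix.det_transpose, Matrix.det_apply]
    refine (Int.natAbs_sum_le _ _).trans (Finset.sum_le_sum fun σ _ => ?_)
    rw [Units.smul_def, smul_eq_mul, Int.natAbs_mul, Int.units_natAbs, one_mul, ← Int.natAbsHom_apply, map_prod]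
    simp
  have h2 : ∏ i, ∑ j, (V i j).natAbs = ∑ f : Fin m → Fin m, ∏ i, (V i (f i)).natAbs := by
    rw [Finset.prod_univ_sum]; simp
  have h3 : ∑ σ : Equiv.Perm (Fin m), ∏ i, (V i (σ i)).natAbs =
      ∑ f ∈ Finset.univ.image (fun σ : Equiv.Perm (Fin m) => (σ : Fin m → Fin m)),
        ∏ i, (V i (f i)).natAbs := by
    rw [Finset.sum_image]
    intro a _ b _ h
    exact DFunLike.coe_injective h
  have h4 := Finset.sum_compl_add_sum
    (Finset.univ.image (fun σ : Equiv.Perm (Fin m) => (σ : Fin m → Fin m)))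
    (fun f => ∏ i, (V i (f i)).natAbs)
  have h5 : ∏ i, ∑ j, (V i j).natAbs ≤ d ^ m := by
    refine (Finset.prod_le_prod' fun i _ => hrow i).trans ?_
    simp
  have hz : ∑ f ∈ (Finset.univ.image (fun σ : Equiv.Perm (Fin m) => (σ : Fin m → Fin m)))ᶜ,
      ∏ i, (V i (f i)).natAbs = 0 := by omega
  have hpe : ∏ i, ∑ j, (V i j).natAbs = d ^ m := by omega
  have hr : ∀ i, ∑ j, (V i j).natAbs = d := by
    intro i
    by_contra hne
    have : ∏ i, ∑ j, (V i j).natAbs < ∏ i : Fin m, d := by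
      refine Finset.prod_lt_prod (fun l _ => Nat.pos_of_ne_zero fun h0 => ?_) (fun l _ => hrow l)
        ⟨i, Finset.mem_univ i, lt_of_le_of_ne (hrow i) hne⟩
      have := Finset.prod_eq_zero (f := fun i => ∑ j, (V i j).natAbs) (Finset.mem_univ l) h0
      have := pow_pos hd m
      omega
    simp at this; omega
  have hpos : 0 < d ^ m := pow_pos hd m
  obtain ⟨σ, hσ⟩ : ∃ σ : Equiv.Perm (Fin m), ∏ i, (V i (σ i)).natAbs ≠ 0 := by
    by_contra! h
    simp [h] at h1
    simp [h1] at hdet; omega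
  have hrow0 : ∀ i l, l ≠ σ i → V i l = 0 := by
    intro i l hl
    by_contra hne
    have := Finset.sum_eq_zero_iff.1 hz (Function.update σ i l) (by
      simp only [Finset.mem_compl, Finset.mem_image, Finset.mem_univ, true_and, not_exists]
      intro τ hτ
      have e1 : τ i = l := by rw [hτ]; simp
      have hi : σ.symm l ≠ i := by rintro rfl; simp at hl
      have e2 : τ (σ.symm l) = l := by rw [hτ, Function.update_of_ne hi]; simp
      exact hi (τ.injective (e2.trans e1.symm)))
    rw [Finset.prod_eq_zero_iff] at this
    obtain ⟨a, -, ha⟩ := this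
    rcases eq_or_ne a i with rfl | hai
    · simp at ha; exact hne ha
    · rw [Function.update_of_ne hai] at ha
      exact hσ (Finset.prod_eq_zero (Finset.mem_univ a) ha)
  refine ⟨σ.symm j, fun l hl => hrow0 _ _ (by simpa using hl), ?_⟩
  rw [← hr (σ.symm j), Finset.sum_eq_single j]
  · intro l _ hl; rw [hrow0 _ _ (by simpa using hl)]; rfl
  · simp

lemma card_le_det {A : Type*} [CommGroup A] {m : ℕ} (e : Fin m → A)
    (hsurj : ∀ a : A, ∃ c : Fin m → ℤ, ∏ i, e i ^ c i = a)
    (V : Matrix (Fin m) (Fin m) ℤ) (hV : ∀ i, ∏ j, e j ^ V i j = 1) (hdet : V.det ≠ 0) :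
    Nat.card A ≤ V.det.natAbs := by
  classical
  let φ : (Fin m → ℤ) →+ Additive A :=
    { toFun := fun c => Additive.ofMul (∏ i, e i ^ c i)
      map_zero' := by simp
      map_add' := fun a b => by simp [zpow_add, Finset.prod_mul_distrib] }
  have hφ : Function.Surjective φ := fun a => by
    obtain ⟨c, hc⟩ := hsurj a.toMul
    exact ⟨c, congrArg Additive.ofMul hc⟩
  have hli : LinearIndependent ℤ V.row := Matrix.linearIndependent_rows_of_det_ne_zero hdet
  let B := Module.Basis.span hli
  let S : Submodule ℤ (Fin m → ℤ) := Submodule.span ℤ (Set.range V.row)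
  have hidx : S.toAddSubgroup.index = V.det.natAbs := by
    rw [AddSubgroup.index_eq_natAbs_det (Pi.basisFun ℤ (Fin m)) S.toAddSubgroup B]
    congr 1
    rw [Pi.basisFun_det_apply]
    congr 1
    ext i j
    exact congrFun (congrArg Subtype.val (Module.Basis.span_apply hli i)) j
  have hle : S.toAddSubgroup ≤ φ.ker := by
    intro x hx
    have : S ≤ (AddSubgroup.toIntSubmodule φ.ker) := by
      rw [Submodule.span_le]
      rintro _ ⟨i, rfl⟩
      simp only [SetLike.mem_coe]
      change φ (V.row i) = 0
      exact congrArg Additive.ofMul (hV i)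
    exact this hx
  have h1 : φ.ker.index = Nat.card A := by
    rw [AddSubgroup.index_ker, AddMonoidHom.range_eq_top.2 hφ]
    exact Nat.card_congr (AddSubgroup.topEquiv.toEquiv.trans Additive.toMul)
  rw [← h1, ← hidx]
  exact Nat.le_of_dvd (Nat.pos_of_ne_zero (by rw [hidx]; simpa using hdet)) (AddSubgroup.index_dvd_of_le hle)

lemma exists_matrix {m : ℕ} (S : Set (Fin m → ℤ))
    (hS : ∀ w : Fin m → ℤ, w ≠ 0 → ∃ v ∈ S, ∑ i, w i * v i ≠ 0) :
    ∃ V : Matrix (Fin m) (Fin m) ℤ, (∀ i, V i ∈ S) ∧ V.det ≠ 0 := by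
  classical
  let c : (Fin m → ℤ) → (Fin m → ℚ) := fun v i => (v i : ℚ)
  have hspan : Submodule.span ℚ (c '' S) = ⊤ := by
    by_contra hne
    obtain ⟨f, hf0, hf⟩ := Submodule.exists_le_ker_of_lt_top _ (lt_top_iff_ne_top.2 hne)
    obtain ⟨b, hb⟩ := IsLocalization.exist_integer_multiples_of_finite (nonZeroDivisors ℤ)
      (fun i => f (Pi.single i 1))
    choose w hw using hb
    have hb0 : ((b : ℤ) : ℚ) ≠ 0 := by exact_mod_cast nonZeroDivisors.coe_ne_zero b
    have hfv : ∀ v : Fin m → ℚ, f v = ∑ i, v i * f (Pi.single i 1) := by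
      intro v
      rw [LinearMap.pi_apply_eq_sum_univ f v]
      refine Finset.sum_congr rfl fun i _ => ?_
      rw [smul_eq_mul]; congr 2; ext j; simp [Pi.single_apply, eq_comm]
    have hwne : w ≠ 0 := by
      rintro rfl
      apply hf0
      ext i
      have := hw i
      simp [Algebra.smul_def] at this
      simpa using this
    obtain ⟨v, hv, hne⟩ := hS w hwne
    apply hne
    have h0 : f (c v) = 0 := hf (Submodule.subset_span ⟨v, hv, rfl⟩)
    rw [hfv] at h0
    have : ((∑ i, w i * v i : ℤ) : ℚ) = (b : ℤ) * ∑ i, c v i * f (Pi.single i 1) := by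
      push_cast
      rw [Finset.mul_sum]
      refine Finset.sum_congr rfl fun i _ => ?_
      have := hw i
      simp [Algebra.smul_def] at this
      rw [this]; simp [c]; ring
    rw [h0, mul_zero] at this
    exact_mod_cast this
  obtain ⟨b, hbS, hbspan, hbli⟩ := exists_linearIndependent ℚ (c '' S)
  rw [hspan] at hbspan
  let B := Module.Basis.mk hbli (by simp [hbspan])
  have : Fintype b := FiniteDimensional.fintypeBasisIndex B
  let E : Fin m ≃ b := (Pi.basisFun ℚ (Fin m)).indexEquiv B
  have hex : ∀ i, ∃ v ∈ S, c v = (E i : Fin m → ℚ) := fun i => hbS (E i).2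
  choose V hVS hV using hex
  refine ⟨V, hVS, fun h0 => ?_⟩
  have hdet : ((Matrix.of V).map (Int.cast : ℤ → ℚ)).det = 0 := by
    have := (Int.castRingHom ℚ).map_det (Matrix.of V)
    rw [show (Matrix.of V).det = 0 from h0] at this
    simpa [RingHom.mapMatrix_apply] using this.symm
  have hli : LinearIndependent ℚ ((Matrix.of V).map (Int.cast : ℤ → ℚ)).row := by
    have := hbli.comp E E.injective
    have hh : ((Matrix.of V).map (Int.cast : ℤ → ℚ)).row = Subtype.val ∘ E := by
      ext i j
      have := congrFun (hV i) j
      simpa [c, Matrix.row] using this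
    rw [hh]
    exact this
  rw [Matrix.linearIndependent_rows_iff_isUnit, Matrix.isUnit_iff_isUnit_det, hdet] at hli
  simp at hli

lemma lattice_main {A : Type*} [CommGroup A] {m d : ℕ} (hd : 0 < d) (e : Fin m → A)
    (hsurj : ∀ a : A, ∃ c : Fin m → ℤ, ∏ i, e i ^ c i = a) (hcard : Nat.card A = d ^ m)
    (hS : ∀ w : Fin m → ℤ, w ≠ 0 →
      ∃ v : Fin m → ℤ, ∏ i, e i ^ v i = 1 ∧ ∑ i, (v i).natAbs ≤ d ∧ ∑ i, w i * v i ≠ 0) (j : Fin m) :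
    e j ^ d = 1 := by
  obtain ⟨V, hV, hdet⟩ := exists_matrix
    {v : Fin m → ℤ | ∏ i, e i ^ v i = 1 ∧ ∑ i, (v i).natAbs ≤ d} (fun w hw => by
      obtain ⟨v, h1, h2, h3⟩ := hS w hw
      exact ⟨v, ⟨h1, h2⟩, h3⟩)
  have h1 := card_le_det e hsurj V (fun i => (hV i).1) hdet
  rw [hcard] at h1
  obtain ⟨i, hi0, hij⟩ := det_eq_case hd V (fun i => (hV i).2) h1 j
  have := (hV i).1
  rw [Finset.prod_eq_single j (fun l _ hl => by rw [hi0 l hl, zpow_zero]) (by simp)] at this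
  rw [← hij]
  exact (pow_natAbs_eq_one).2 this

lemma char_sum_eq_zero {K : Type*} [Field K] [IsAlgClosed K] {G : Type*} [CommGroup G] [Fintype G]
    [Fintype (G →* Kˣ)]
    (hchar : (Fintype.card G : K) ≠ 0) (g : G) (hg : g ≠ 1) : ∑ χ : G →* Kˣ, (χ g : K) = 0 := by
  have : NeZero ((Monoid.exponent G : ℕ) : K) := ⟨fun h => hchar (by
    obtain ⟨c, hc⟩ := Group.exponent_dvd_card (G := G)
    rw [hc]; push_cast; rw [h, zero_mul])⟩
  obtain ⟨ψ, hψ⟩ := CommGroup.exists_apply_ne_one_of_hasEnoughRootsOfUnity G K hg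
  have h1 : (ψ g : K) * ∑ χ : G →* Kˣ, (χ g : K) = ∑ χ : G →* Kˣ, (χ g : K) := by
    rw [Finset.mul_sum]
    exact Fintype.sum_equiv (Equiv.mulLeft ψ) _ _ (fun χ => by simp)
  have h2 : ((ψ g : K) - 1) * ∑ χ : G →* Kˣ, (χ g : K) = 0 := by rw [sub_mul, h1]; ring
  refine (mul_eq_zero.1 h2).resolve_left fun h => hψ ?_
  ext; simpa using sub_eq_zero.1 h

lemma exists_diag {K : Type*} [Field K] [IsAlgClosed K] {G : Type*} [CommGroup G] [Fintype G] {N : ℕ}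
    (hchar : (Fintype.card G : K) ≠ 0) (M : G →* GL (Fin N) K) :
    ∃ (P : GL (Fin N) K) (χ : Fin N → (G →* Kˣ)), ∀ g,
      (M g : Matrix (Fin N) (Fin N) K) * P = P * Matrix.diagonal (fun j => (χ j g : K)) := by
  classical
  have hNZ : NeZero ((Monoid.exponent G : ℕ) : K) := ⟨fun h => hchar (by
    obtain ⟨c, hc⟩ := Group.exponent_dvd_card (G := G)
    rw [hc]; push_cast; rw [h, zero_mul])⟩
  have hcd := CommGroup.card_monoidHom_of_hasEnoughRootsOfUnity G K
  have : Finite (G →* Kˣ) := Nat.finite_of_card_ne_zero (by rw [hcd]; exact Nat.card_pos.ne')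
  have : Fintype (G →* Kˣ) := Fintype.ofFinite _
  let E : Set (Fin N → K) := {v | ∃ χ : G →* Kˣ, ∀ g, (M g : Matrix (Fin N) (Fin N) K).mulVec v = (χ g : K) • v}
  have hE : Submodule.span K E = ⊤ := by
    rw [eq_top_iff]
    intro v _
    let p : (G →* Kˣ) → (Fin N → K) := fun χ => ∑ g, (χ g⁻¹ : K) • (M g : Matrix (Fin N) (Fin N) K).mulVec v
    have hp : ∀ χ, p χ ∈ E := by
      intro χ
      refine ⟨χ, fun h => ?_⟩
      simp only [p, Matrix.mulVec_sum, Finset.smul_sum, Matrix.mulVec_smul, Matrix.mulVec_mulVec]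
      refine Fintype.sum_equiv (Equiv.mulLeft h) _ _ (fun g => ?_)
      simp [smul_smul, mul_comm]
    have hsum : ∑ χ, p χ = (Fintype.card G : K) • v := by
      simp only [p]
      rw [Finset.sum_comm]
      simp_rw [← Finset.sum_smul]
      rw [Finset.sum_eq_single 1]
      · simp only [inv_one, map_one, Units.val_one, Matrix.one_mulVec, Finset.sum_const, Finset.card_univ]
        rw [← Nat.card_eq_fintype_card, hcd]; simp
      · intro g _ hg
        rw [char_sum_eq_zero hchar _ (inv_ne_one.2 hg), zero_smul]
      · simp
    have : v = (Fintype.card G : K)⁻¹ • ∑ χ, p χ := by rw [hsum, smul_smul, inv_mul_cancel₀ hchar, one_smul]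
    rw [this]
    exact Submodule.smul_mem _ _ (Submodule.sum_mem _ fun χ _ => Submodule.subset_span (hp χ))
  obtain ⟨b, hbS, hbspan, hbli⟩ := exists_linearIndependent K E
  rw [hE] at hbspan
  let B := Module.Basis.mk hbli (by simp [hbspan])
  have : Fintype b := FiniteDimensional.fintypeBasisIndex B
  let e : Fin N ≃ b := (Pi.basisFun K (Fin N)).indexEquiv B
  have hex : ∀ j, ∃ χ : G →* Kˣ, ∀ g, (M g : Matrix (Fin N) (Fin N) K).mulVec (e j) = (χ g : K) • (e j : Fin N → K) :=
    fun j => hbS (e j).2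
  choose χ hχ using hex
  let Q : Matrix (Fin N) (Fin N) K := Matrix.of fun i j => (e j : Fin N → K) i
  have hQ : IsUnit Q := by
    rw [← Matrix.linearIndependent_cols_iff_isUnit]
    exact hbli.comp e e.injective
  refine ⟨hQ.unit, χ, fun g => ?_⟩
  rw [IsUnit.unit_spec]
  ext i j
  rw [Matrix.mul_diagonal, mul_comm]
  exact congrFun (hχ j g) i

lemma mAct_diag_coeff_s12 {N : ℕ} {K : Type} [Field K] (τ : Fin N → K) (F : MvPolynomial (Fin N) K) (a : Fin N →₀ ℕ) :
    coeff a (mAct (Matrix.diagonal τ) F) = (∏ j, τ j ^ a j) * coeff a F := by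
  classical
  have hX : ∀ i : Fin N, (∑ j, C (Matrix.diagonal τ i j) * X j : MvPolynomial (Fin N) K) = C (τ i) * X i := by
    intro i
    rw [Finset.sum_eq_single i]
    · simp
    · intro j _ hj; rw [Matrix.diagonal_apply_ne' _ hj]; simp
    · simp
  induction F using MvPolynomial.induction_on' with
  | add p q hp hq => rw [map_add, coeff_add, coeff_add, hp, hq]; ring
  | monomial b c =>
    have : mAct (Matrix.diagonal τ) (monomial b c) = monomial b ((∏ j, τ j ^ b j) * c) := by
      simp only [mAct, aeval_monomial, hX, mul_pow, algebraMap_eq]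
      rw [Finsupp.prod_fintype _ _ (by simp), Finset.prod_mul_distrib]
      rw [monomial_eq, Finsupp.prod_fintype _ _ (by simp)]
      simp [map_prod, map_pow]; ring
    rw [this, coeff_monomial, coeff_monomial]
    split_ifs with h
    · rw [h]
    · simp

lemma mAct_totalDegree {N : ℕ} {K : Type} [Field K] (A : Matrix (Fin N) (Fin N) K) (F : MvPolynomial (Fin N) K) :
    (mAct A F).totalDegree ≤ F.totalDegree := by
  have hlin : ∀ i : Fin N, (∑ j, C (A i j) * X j : MvPolynomial (Fin N) K).totalDegree ≤ 1 := by
    intro i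
    refine totalDegree_finsetSum_le fun j _ => ?_
    refine (totalDegree_mul _ _).trans ?_
    simp
  rw [mAct, aeval_def, eval₂_eq']
  refine totalDegree_finsetSum_le fun a ha => ?_
  refine (totalDegree_mul _ _).trans ?_
  rw [algebraMap_eq, totalDegree_C, zero_add]
  refine (totalDegree_finsetProd _ _).trans ?_
  refine le_trans (Finset.sum_le_sum (g := fun i => a i) fun i _ => ?_) ?_
  · exact (totalDegree_pow _ _).trans (by have := hlin i; nlinarith)
  · have := le_totalDegree ha
    rwa [Finsupp.sum_fintype _ _ (by simp)] at this

lemma semi_inv {k : Type} [Field k] {N : ℕ} {G : Type} [CommGroup G] (ρ : G →* GL (Fin N) k)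
    (f : FractionRing (MvPolynomial (Fin N) k)) (hf : IsInv (fun g => ρ g) f)
    (f₁ f₂ : MvPolynomial (Fin N) k) (h1 : f₁ ≠ 0) (h2 : f₂ ≠ 0)
    (hcop : ∀ p : MvPolynomial (Fin N) k, p ∣ f₁ → p ∣ f₂ → IsUnit p)
    (hff : f = algebraMap (MvPolynomial (Fin N) k) (FractionRing (MvPolynomial (Fin N) k)) f₁ /
        algebraMap (MvPolynomial (Fin N) k) (FractionRing (MvPolynomial (Fin N) k)) f₂) (g : G) :
    ∃ c : k, mAct (ρ g : Matrix (Fin N) (Fin N) k) f₁ = C c * f₁ ∧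
      mAct (ρ g : Matrix (Fin N) (Fin N) k) f₂ = C c * f₂ := by
  have hinj := IsFractionRing.injective (MvPolynomial (Fin N) k) (FractionRing (MvPolynomial (Fin N) k))
  have hne : ∀ (h : G) (p : MvPolynomial (Fin N) k), p ≠ 0 → mAct (ρ h : Matrix (Fin N) (Fin N) k) p ≠ 0 := by
    intro h p hp
    have : (mEquiv (ρ h)) p ≠ 0 := by simpa using hp
    exact this
  have hmul : ∀ h : G, mAct (ρ h : Matrix (Fin N) (Fin N) k) f₁ * f₂ =
      f₁ * mAct (ρ h : Matrix (Fin N) (Fin N) k) f₂ := by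
    intro h
    have e1 := hf h
    have e2 : ∀ p, fAct (ρ h) (algebraMap _ (FractionRing (MvPolynomial (Fin N) k)) p) =
        algebraMap _ (FractionRing (MvPolynomial (Fin N) k)) (mAct (ρ h : Matrix (Fin N) (Fin N) k) p) := by
      intro p
      exact IsFractionRing.ringEquivOfRingEquiv_algebraMap _ _
    rw [hff, map_div₀, e2, e2, div_eq_div_iff] at e1
    · rw [← map_mul, ← map_mul] at e1
      exact hinj e1
    · exact fun h0 => hne h _ h2 (hinj (by rw [h0, map_zero]))
    · exact fun h0 => h2 (hinj (by rw [h0, map_zero]))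
  have hrel : IsRelPrime f₁ f₂ := fun p => hcop p
  have hdvd : ∀ h : G, f₁ ∣ mAct (ρ h : Matrix (Fin N) (Fin N) k) f₁ := fun h =>
    hrel.dvd_of_dvd_mul_right ⟨_, hmul h⟩
  have hass : Associated f₁ (mAct (ρ g : Matrix (Fin N) (Fin N) k) f₁) := by
    refine associated_of_dvd_dvd (hdvd g) ?_
    have := map_dvd (mAct (ρ g : Matrix (Fin N) (Fin N) k)) (hdvd g⁻¹)
    rwa [← AlgHom.comp_apply, mAct_comp, ← Units.val_mul, ← map_mul, inv_mul_cancel, map_one,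
      Units.val_one, mAct_one] at this
  obtain ⟨u, hu⟩ := hass
  obtain ⟨c, hc, huc⟩ := MvPolynomial.isUnit_iff_eq_C_of_isReduced.1 u.isUnit
  refine ⟨c, by rw [← hu, huc, mul_comm], ?_⟩
  have := hmul g
  rw [← hu, huc, mul_assoc] at this
  exact (mul_left_cancel₀ h1 this).symm

lemma mAct_map {k K : Type} [Field k] [Field K] [Algebra k K] {N : ℕ} (A : Matrix (Fin N) (Fin N) k)
    (f : MvPolynomial (Fin N) k) :
    map (algebraMap k K) (mAct A f) = mAct (A.map (algebraMap k K)) (map (algebraMap k K) f) := by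
  induction f using MvPolynomial.induction_on with
  | C a => simp [mAct, algebraMap_eq]
  | add p q hp hq => simp [hp, hq]
  | mul_X p i hp => 
    rw [map_mul, map_mul, map_mul, map_mul, hp]
    congr 1
    simp [mAct]

lemma exps {k K : Type} [Field k] [Field K] [Algebra k K] {N : ℕ} {G : Type} [CommGroup G]
    (ρ : G →* GL (Fin N) k) (P : GL (Fin N) K) (χ : Fin N → (G →* Kˣ))
    (hP : ∀ g, ((ρ g : Matrix (Fin N) (Fin N) k).map (algebraMap k K)) * P =
      P * Matrix.diagonal (fun j => (χ j g : K))) (d : ℕ)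
    (f : FractionRing (MvPolynomial (Fin N) k)) (hf : IsInv (fun g => ρ g) f) (hd : RDegLE f d) :
    ∃ f₁ f₂ : MvPolynomial (Fin N) k, f₂ ≠ 0 ∧ 
      f = algebraMap (MvPolynomial (Fin N) k) (FractionRing (MvPolynomial (Fin N) k)) f₁ /
        algebraMap (MvPolynomial (Fin N) k) (FractionRing (MvPolynomial (Fin N) k)) f₂ ∧
      ∀ a ∈ (mAct (P : Matrix (Fin N) (Fin N) K) (map (algebraMap k K) f₁)).support,
      ∀ b ∈ (mAct (P : Matrix (Fin N) (Fin N) K) (map (algebraMap k K) f₂)).support,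
        ∏ j, χ j ^ a j = ∏ j, χ j ^ b j ∧ ∑ j, a j + ∑ j, b j ≤ d := by
  obtain ⟨f₁, f₂, h2, hcop, hff, hdeg⟩ := hd
  refine ⟨f₁, f₂, h2, hff, fun a ha b hb => ?_⟩
  have h1 : f₁ ≠ 0 := by rintro rfl; simp at ha
  have key : ∀ (g : G) (c : k) (p : MvPolynomial (Fin N) k) (a : Fin N →₀ ℕ),
      a ∈ (mAct (P : Matrix (Fin N) (Fin N) K) (map (algebraMap k K) p)).support →
      mAct (ρ g : Matrix (Fin N) (Fin N) k) p = C c * p → ∏ j, (χ j g : K) ^ a j = algebraMap k K c := by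
    intro g c p a ha hp
    have e1 := congrArg (fun q => coeff a (mAct (P : Matrix (Fin N) (Fin N) K) (map (algebraMap k K) q))) hp
    simp only [mAct_map] at e1
    rw [← AlgHom.comp_apply, mAct_comp, hP, ← mAct_comp, AlgHom.comp_apply, mAct_diag_coeff_s12] at e1
    rw [map_mul, map_mul, map_C, show mAct (P : Matrix (Fin N) (Fin N) K) (C (algebraMap k K c)) = C (algebraMap k K c) from by simp [mAct, algebraMap_eq], coeff_C_mul] at e1
    exact mul_right_cancel₀ (mem_support_iff.1 ha) e1
  constructor
  · ext g
    obtain ⟨c, hc1, hc2⟩ := semi_inv ρ f hf f₁ f₂ h1 h2 hcop hff g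
    have e1 := key g c f₁ a ha hc1
    have e2 := key g c f₂ b hb hc2
    simp only [MonoidHom.finsetProd_apply, MonoidHom.pow_apply, Units.coe_prod, Units.val_pow_eq_pow_val]
    rw [e1, e2]
  · have hle : ∀ (p : MvPolynomial (Fin N) k) (a : Fin N →₀ ℕ), 
      a ∈ (mAct (P : Matrix (Fin N) (Fin N) K) (map (algebraMap k K) p)).support →
      ∑ j, a j ≤ p.totalDegree := by
      intro p a ha
      have := le_totalDegree ha
      rw [Finsupp.sum_fintype _ _ (by simp)] at this
      refine this.trans ((mAct_totalDegree _ _).trans ?_)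
      exact Finset.sup_mono (support_map_subset _ _)
    have := hle _ _ ha
    have := hle _ _ hb
    omega

/-- The embedding of `k(V)` into `K(V)` twisted by `Q`. -/
def iota {k K : Type} [Field k] [Field K] [Algebra k K] {N : ℕ} (Q : GL (Fin N) K) :
    FractionRing (MvPolynomial (Fin N) k) →+* FractionRing (MvPolynomial (Fin N) K) :=
  IsFractionRing.lift (A := MvPolynomial (Fin N) k)
    (g := (algebraMap (MvPolynomial (Fin N) K) (FractionRing (MvPolynomial (Fin N) K))).comp
      ((mAct (Q : Matrix (Fin N) (Fin N) K)).toRingHom.comp (map (algebraMap k K))))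
    ((IsFractionRing.injective (MvPolynomial (Fin N) K) (FractionRing (MvPolynomial (Fin N) K))).comp
      ((mEquiv Q).injective.comp (map_injective _ (algebraMap k K).injective)))

lemma iota_algebraMap {k K : Type} [Field k] [Field K] [Algebra k K] {N : ℕ} (Q : GL (Fin N) K)
    (p : MvPolynomial (Fin N) k) :
    iota Q (algebraMap _ (FractionRing (MvPolynomial (Fin N) k)) p) =
      algebraMap _ (FractionRing (MvPolynomial (Fin N) K))
        (mAct (Q : Matrix (Fin N) (Fin N) K) (map (algebraMap k K) p)) :=
  IsFractionRing.lift_algebraMap _ _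

lemma iota_fix {k K : Type} [Field k] [Field K] [Algebra k K] {N : ℕ} (P Q : GL (Fin N) K)
    (τ : Fin N → K) (hτ : ∀ j, τ j ≠ 0)
    (hQ : (Q : Matrix (Fin N) (Fin N) K) = P * Matrix.diagonal τ)
    (f₁ f₂ : MvPolynomial (Fin N) k) (h2 : f₂ ≠ 0)
    (h : ∀ a ∈ (mAct (P : Matrix (Fin N) (Fin N) K) (map (algebraMap k K) f₁)).support,
      ∀ b ∈ (mAct (P : Matrix (Fin N) (Fin N) K) (map (algebraMap k K) f₂)).support,
      ∏ j, τ j ^ a j = ∏ j, τ j ^ b j) :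
    iota Q (algebraMap (MvPolynomial (Fin N) k) (FractionRing (MvPolynomial (Fin N) k)) f₁ /
        algebraMap (MvPolynomial (Fin N) k) (FractionRing (MvPolynomial (Fin N) k)) f₂) =
    iota P (algebraMap (MvPolynomial (Fin N) k) (FractionRing (MvPolynomial (Fin N) k)) f₁ /
        algebraMap (MvPolynomial (Fin N) k) (FractionRing (MvPolynomial (Fin N) k)) f₂) := by
  rcases eq_or_ne f₁ 0 with rfl | h1
  · simp
  have hne : ∀ p : MvPolynomial (Fin N) k, p ≠ 0 → mAct (P : Matrix (Fin N) (Fin N) K) (map (algebraMap k K) p) ≠ 0 := by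
    intro p hp h0
    exact hp ((map_injective _ (algebraMap k K).injective) ((mEquiv P).injective (by
      rw [map_zero, map_zero]; exact h0)))
  obtain ⟨a₀, ha₀⟩ := support_nonempty.2 (hne _ h1)
  obtain ⟨b₀, hb₀⟩ := support_nonempty.2 (hne _ h2)
  set n := ∏ j, τ j ^ b₀ j with hn
  have hn0 : n ≠ 0 := Finset.prod_ne_zero_iff.2 fun j _ => pow_ne_zero _ (hτ j)
  have hs : ∀ F : MvPolynomial (Fin N) K, (∀ a ∈ F.support, ∏ j, τ j ^ a j = n) →
      mAct (Matrix.diagonal τ) F = C n * F := by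
    intro F hF
    ext a
    rw [mAct_diag_coeff_s12, coeff_C_mul]
    by_cases ha : a ∈ F.support
    · rw [hF a ha]
    · rw [notMem_support_iff.1 ha]; simp
  have e1 := hs _ (fun a ha => h a ha b₀ hb₀)
  have e2 := hs _ (fun b hb => (h a₀ ha₀ b hb).symm.trans (h a₀ ha₀ b₀ hb₀))
  rw [map_div₀, map_div₀, iota_algebraMap, iota_algebraMap, iota_algebraMap, iota_algebraMap, hQ, ← mAct_comp,
    AlgHom.comp_apply, AlgHom.comp_apply, e1, e2, map_mul, map_mul]
  refine mul_div_mul_left _ _ ?_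
  rw [map_ne_zero_iff _ (IsFractionRing.injective _ _)]
  simpa using hn0

lemma my_zpow_sum {ι A : Type*} [CommGroup A] (t : A) (s : Finset ι) (f : ι → ℤ) :
    t ^ (∑ j ∈ s, f j) = ∏ j ∈ s, t ^ f j := by
  classical
  induction s using Finset.induction_on with
  | empty => simp
  | insert a s ha ih => rw [Finset.sum_insert ha, Finset.prod_insert ha, zpow_add, ih]

lemma fAct_algebraMap {k : Type} [Field k] {N : ℕ} (A : GL (Fin N) k) (p : MvPolynomial (Fin N) k) :
    fAct A (algebraMap _ (FractionRing (MvPolynomial (Fin N) k)) p) =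
        algebraMap _ (FractionRing (MvPolynomial (Fin N) k)) (mAct (A : Matrix (Fin N) (Fin N) k) p) :=
  IsFractionRing.ringEquivOfRingEquiv_algebraMap _ _

lemma fAct_fAct {k : Type} [Field k] {N : ℕ} (A B : GL (Fin N) k) (x : FractionRing (MvPolynomial (Fin N) k)) :
    fAct A (fAct B x) = fAct (B * A) x := by
  obtain ⟨a, b, -, rfl⟩ := IsFractionRing.div_surjective (A := MvPolynomial (Fin N) k) x
  simp only [map_div₀, fAct_algebraMap]
  rw [← AlgHom.comp_apply, ← AlgHom.comp_apply, mAct_comp, Units.val_mul]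

lemma fAct_one {k : Type} [Field k] {N : ℕ} (x : FractionRing (MvPolynomial (Fin N) k)) :
    fAct 1 x = x := by
  obtain ⟨a, b, -, rfl⟩ := IsFractionRing.div_surjective (A := MvPolynomial (Fin N) k) x
  simp only [map_div₀, fAct_algebraMap, Units.val_one, mAct_one, AlgHom.id_apply]

lemma all_alg {k : Type} [Field k] {N : ℕ} {G : Type} [CommGroup G] [Fintype G] (ρ : G →* GL (Fin N) k)
    (F : IntermediateField k (FractionRing (MvPolynomial (Fin N) k)))
    (h : ∀ f, IsInv (fun g => ρ g) f → IsAlgebraic F f) (x : FractionRing (MvPolynomial (Fin N) k)) :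
    IsAlgebraic F x := by
  classical
  let q : Polynomial (FractionRing (MvPolynomial (Fin N) k)) :=
    ∏ g : G, (Polynomial.X - Polynomial.C (fAct (ρ g) x))
  have hqm : q.Monic := Polynomial.monic_prod_of_monic _ _ fun g _ => Polynomial.monic_X_sub_C _
  have hq0 : q.eval x = 0 := by
    rw [Polynomial.eval_prod]
    refine Finset.prod_eq_zero (Finset.mem_univ 1) ?_
    rw [map_one, fAct_one]; simp
  have hinv : ∀ g, q.map ((fAct (ρ g)) : FractionRing (MvPolynomial (Fin N) k) →+* _) = q := by
    intro g
    simp only [q, Polynomial.map_prod, Polynomial.map_sub, Polynomial.map_X, Polynomial.map_C]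
    refine Fintype.prod_equiv (Equiv.mulRight g) _ _ fun h => ?_
    simp only [RingHom.coe_coe, fAct_fAct, Equiv.coe_mulRight, map_mul]
  let E := algebraicClosure F (FractionRing (MvPolynomial (Fin N) k))
  have hcoef : ∀ n, q.coeff n ∈ E := by
    intro n
    rw [mem_algebraicClosure_iff]
    refine h _ fun g => ?_
    conv_rhs => rw [← hinv g, Polynomial.coeff_map]
    rfl
  obtain ⟨r, hr⟩ : ∃ r : Polynomial E, r.map (algebraMap E (FractionRing (MvPolynomial (Fin N) k))) = q := by
    have : q ∈ Polynomial.lifts (algebraMap E (FractionRing (MvPolynomial (Fin N) k))) := by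
      rw [Polynomial.lifts_iff_coeff_lifts]
      intro n
      exact ⟨⟨_, hcoef n⟩, rfl⟩
    exact (Polynomial.mem_lifts _).1 this
  have hx : IsAlgebraic E x := by
    refine ⟨r, ?_, ?_⟩
    · rintro rfl
      rw [Polynomial.map_zero] at hr
      exact hqm.ne_zero hr.symm
    · rw [Polynomial.aeval_def, ← Polynomial.eval_map, hr, hq0]
  exact hx.restrictScalars F

lemma iota_finite {k K : Type} [Field k] [Field K] [Algebra k K] {N : ℕ} {T : Type*}
    (s : Set (FractionRing (MvPolynomial (Fin N) k)))
    (x : FractionRing (MvPolynomial (Fin N) k)) (hx : IsAlgebraic (IntermediateField.adjoin k s) x)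
    (P : GL (Fin N) K) (Q : T → GL (Fin N) K) (hQ : ∀ t, ∀ f ∈ s, iota (Q t) f = iota P f) :
    (Set.range fun t => iota (Q t) x).Finite := by
  classical
  have hagree : ∀ t, ∀ f ∈ IntermediateField.adjoin k s, iota (Q t) f = iota P f := by
    intro t f hf
    induction hf using IntermediateField.adjoin_induction with
    | mem x hx => exact hQ t x hx
    | algebraMap c =>
      rw [IsScalarTower.algebraMap_apply k (MvPolynomial (Fin N) k), iota_algebraMap, iota_algebraMap]
      simp [mAct, algebraMap_eq]
    | add x y _ _ hx hy => rw [map_add, map_add, hx, hy]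
    | mul x y _ _ hx hy => rw [map_mul, map_mul, hx, hy]
    | inv x _ hx => rw [map_inv₀, map_inv₀, hx]
  obtain ⟨p, hp, hpx⟩ := hx
  let φ : IntermediateField.adjoin k s →+* FractionRing (MvPolynomial (Fin N) K) :=
    (iota (k := k) P).comp (algebraMap _ _)
  refine ((p.map φ).roots.toFinset.finite_toSet).subset ?_
  rintro _ ⟨t, rfl⟩
  simp only [Finset.mem_coe, Multiset.mem_toFinset]
  rw [Polynomial.mem_roots (by rw [Ne, Polynomial.map_eq_zero]; exact hp), Polynomial.IsRoot, Polynomial.eval_map]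
  have hφ : φ = (iota (k := k) (Q t)).comp (algebraMap (IntermediateField.adjoin k s) _) := by
    ext ⟨f, hf⟩
    exact (hagree t f hf).symm
  rw [hφ, ← Polynomial.hom_eval₂]
  rw [Polynomial.aeval_def] at hpx
  rw [hpx, map_zero]

lemma claimA {k K : Type} [Field k] [Field K] [Algebra k K] [IsAlgClosed K] {N : ℕ} {G : Type}
    [CommGroup G] [Fintype G]
    (ρ : G →* GL (Fin N) k) (P : GL (Fin N) K) (χ : Fin N → (G →* Kˣ))
    (hP : ∀ g, ((ρ g : Matrix (Fin N) (Fin N) k).map (algebraMap k K)) * P =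
      P * Matrix.diagonal (fun j => (χ j g : K))) (d : ℕ)
    (s : Set (FractionRing (MvPolynomial (Fin N) k)))
    (hs : ∀ f ∈ s, IsInv (fun g => ρ g) f ∧ RDegLE f d)
    (halg : ∀ f, IsInv (fun g => ρ g) f → IsAlgebraic (IntermediateField.adjoin k s) f)
    (u : Fin N → ℤ) (j₀ : Fin N) (hu : u j₀ ≠ 0) :
    ∃ a b : Fin N → ℕ, ∏ j, χ j ^ a j = ∏ j, χ j ^ b j ∧ ∑ j, a j + ∑ j, b j ≤ d ∧
      ∑ j, u j * a j ≠ ∑ j, u j * b j := by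
  classical
  by_contra! hcon
  let τ : Kˣ → Fin N → Kˣ := fun t j => t ^ u j
  let D : Kˣ → GL (Fin N) K := fun t => ⟨Matrix.diagonal fun j => (τ t j : K),
    Matrix.diagonal fun j => ((τ t j)⁻¹ : Kˣ), by simp, by simp⟩
  have hfix : ∀ t, ∀ f ∈ s, iota (P * D t) f = iota P f := by
    intro t f hf
    obtain ⟨f₁, f₂, h2, hff, hab⟩ := exps ρ P χ hP d f (hs f hf).1 (hs f hf).2
    rw [hff]
    refine iota_fix P (P * D t) (fun j => (τ t j : K)) (fun j => (τ t j).ne_zero) rfl f₁ f₂ h2 ?_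
    intro a ha b hb
    obtain ⟨e1, e2⟩ := hab a ha b hb
    have e3 := hcon a b e1 e2
    have e4 : ∀ a : Fin N →₀ ℕ, ∏ j, (τ t j : K) ^ a j = ((t ^ (∑ j, u j * (a j : ℤ)) : Kˣ) : K) := by
      intro a
      rw [my_zpow_sum, Units.coe_prod]
      refine Finset.prod_congr rfl fun j _ => ?_
      simp only [τ]
      rw [zpow_mul, zpow_natCast, Units.val_pow_eq_pow_val]
    rw [e4, e4, e3]
  let x : Fin N → FractionRing (MvPolynomial (Fin N) k) := fun i => algebraMap _ _ (X i : MvPolynomial (Fin N) k)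
  have hfin : ∀ i, (Set.range fun t => iota (P * D t) (x i)).Finite := fun i =>
    iota_finite s (x i) (all_alg ρ _ halg _) P _ hfix
  have hfinpi : (Set.range fun t i => iota (P * D t) (x i)).Finite := by
    refine (Set.Finite.pi' hfin).subset ?_
    rintro _ ⟨t, rfl⟩ i
    exact ⟨t, rfl⟩
  let c : Fin N → K := fun i => ((P⁻¹ : GL (Fin N) K) : Matrix (Fin N) (Fin N) K) j₀ i
  let Φ : (Fin N → FractionRing (MvPolynomial (Fin N) K)) → FractionRing (MvPolynomial (Fin N) K) :=
    fun z => ∑ i, algebraMap _ _ (C (c i) : MvPolynomial (Fin N) K) * z i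
  have hΦ : ∀ t, Φ (fun i => iota (P * D t) (x i)) = algebraMap _ _ (C (τ t j₀ : K) * X j₀ : MvPolynomial (Fin N) K) := by
    intro t
    simp only [Φ, x, iota_algebraMap, ← map_mul, ← map_sum]
    congr 1
    have hcm : ∀ i, c i = ((P⁻¹ : GL (Fin N) K) : Matrix (Fin N) (Fin N) K) j₀ i := fun i => rfl
    have hm : ((P⁻¹ : GL (Fin N) K) : Matrix (Fin N) (Fin N) K) * ((P * D t : GL (Fin N) K) : Matrix (Fin N) (Fin N) K) =
        Matrix.diagonal fun j => (τ t j : K) := by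
      rw [← Units.val_mul, inv_mul_cancel_left]
    simp only [map_X, mAct, aeval_X, Finset.mul_sum, hcm]
    rw [Finset.sum_comm]
    simp_rw [← mul_assoc, ← C_mul, ← Finset.sum_mul, ← map_sum, ← Matrix.mul_apply, hm]
    rw [Finset.sum_eq_single j₀]
    · simp
    · intro j _ hj; rw [Matrix.diagonal_apply_ne' _ hj]; simp
    · simp
  have hfin2 : (Set.range fun t => (C (τ t j₀ : K) * X j₀ : MvPolynomial (Fin N) K)).Finite := by
    refine Set.Finite.of_finite_image (f := algebraMap _ (FractionRing (MvPolynomial (Fin N) K))) ?_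
      ((IsFractionRing.injective _ _).injOn)
    refine (hfinpi.image Φ).subset ?_
    rintro _ ⟨_, ⟨t, rfl⟩, rfl⟩
    exact ⟨_, ⟨t, rfl⟩, hΦ t⟩
  have hfin3 : (Set.range fun t => (τ t j₀ : K)).Finite := by
    refine (hfin2.image (fun F => coeff (Finsupp.single j₀ 1) F)).subset ?_
    rintro _ ⟨t, rfl⟩
    exact ⟨_, ⟨t, rfl⟩, by simp [coeff_C_mul]⟩
  have hinf : Infinite K := IsAlgClosed.instInfinite
  have hsub : {y : K | y ≠ 0} ⊆ Set.range fun t => (τ t j₀ : K) := by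
    intro y hy
    obtain ⟨z, hz⟩ := IsAlgClosed.exists_pow_nat_eq y (Int.natAbs_pos.2 hu)
    have hz0 : z ≠ 0 := by rintro rfl; rw [zero_pow (by simpa using hu)] at hz; exact hy hz.symm
    rcases Int.natAbs_eq (u j₀) with h | h
    · refine ⟨Units.mk0 z hz0, ?_⟩
      simp only [τ]; rw [h, zpow_natCast]; simpa using hz
    · refine ⟨(Units.mk0 z hz0)⁻¹, ?_⟩
      simp only [τ]; rw [h, zpow_neg, zpow_natCast]; simpa using hz
  have : ({y : K | y ≠ 0}).Infinite := by
    have : {y : K | y ≠ 0} = ({0} : Set K)ᶜ := by ext; simp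
    rw [this]
    exact (Set.finite_singleton 0).infinite_compl
  exact this (hfin3.subset hsub)

lemma prod_id {A : Type*} [CommGroup A] [DecidableEq A] {m N : ℕ} (e : Fin m → A) (χ : Fin N → A)
    (he : Function.Injective e) (h1 : ∀ j, χ j ≠ 1 → ∃ i, e i = χ j) (a b : Fin N → ℕ)
    (hab : ∏ j, χ j ^ a j = ∏ j, χ j ^ b j) :
    ∏ i, e i ^ (∑ j, if e i = χ j then ((a j : ℤ) - b j) else 0) = 1 := by
  have : ∀ j, ∏ i, e i ^ (if e i = χ j then ((a j : ℤ) - b j) else 0) = χ j ^ ((a j : ℤ) - b j) := by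
    intro j
    by_cases hj : χ j = 1
    · rw [hj, one_zpow]
      refine Finset.prod_eq_one fun i _ => ?_
      split_ifs with h
      · rw [h, one_zpow]
      · simp
    · obtain ⟨i, hi⟩ := h1 j hj
      rw [Finset.prod_eq_single i]
      · rw [if_pos hi, hi]
      · intro l _ hl
        rw [if_neg (by rw [← hi]; exact fun h => hl (he h)), zpow_zero]
      · simp
  simp only [my_zpow_sum]
  rw [Finset.prod_comm]
  simp only [this, zpow_sub, zpow_natCast, Finset.prod_mul_distrib, hab, Finset.prod_inv_distrib, mul_inv_cancel]

def genSub {A : Type*} [CommGroup A] {m : ℕ} (e : Fin m → A) : Subgroup A :=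
  { carrier := {ψ | ∃ c : Fin m → ℤ, ∏ i, e i ^ c i = ψ}
    one_mem' := ⟨0, by simp⟩
    mul_mem' := by
      rintro _ _ ⟨a, rfl⟩ ⟨b, rfl⟩
      exact ⟨a + b, by simp [zpow_add, Finset.prod_mul_distrib]⟩
    inv_mem' := by
      rintro _ ⟨a, rfl⟩
      exact ⟨-a, by simp⟩ }

lemma mem_genSub {A : Type*} [CommGroup A] {m : ℕ} (e : Fin m → A) (i : Fin m) : e i ∈ genSub e := by
  classical
  refine ⟨Pi.single i 1, ?_⟩
  rw [Finset.prod_eq_single i]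
  · simp
  · intro j _ hj; simp [hj]
  · simp

lemma prod_single {A : Type*} [CommGroup A] {m d : ℕ} [NeZero d] (e : Fin m → A) (l : Fin m) (n : ℕ)
    (hn : n < d) : ∏ i, e i ^ ((Pi.single l (n : ZMod d) : Fin m → ZMod d) i).val = e l ^ n := by
  classical
  rw [Finset.prod_eq_single l]
  · rw [Pi.single_eq_same, ZMod.val_natCast_of_lt hn]
  · intro a _ ha; rw [Pi.single_eq_of_ne ha]; simp
  · simp

lemma claimB {k K : Type} [Field k] [Field K] [Algebra k K] [IsAlgClosed K] {N : ℕ} {G : Type}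
    [CommGroup G] [Fintype G]
    (ρ : G →* GL (Fin N) k) (P : GL (Fin N) K) (χ : Fin N → (G →* Kˣ))
    (hP : ∀ g, ((ρ g : Matrix (Fin N) (Fin N) k).map (algebraMap k K)) * P =
      P * Matrix.diagonal (fun j => (χ j g : K))) (d : ℕ)
    (s : Set (FractionRing (MvPolynomial (Fin N) k)))
    (hs : ∀ f ∈ s, IsInv (fun g => ρ g) f ∧ RDegLE f d)
    (halg : ∀ f, IsInv (fun g => ρ g) f → IsAlgebraic (IntermediateField.adjoin k s) f)
    {m : ℕ} (e : Fin m → (G →* Kˣ)) (he : Function.Injective e)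
    (h1 : ∀ j, χ j ≠ 1 → ∃ i, e i = χ j) (h2 : ∀ i, ∃ j, χ j = e i)
    (w : Fin m → ℤ) (hw : w ≠ 0) :
    ∃ v : Fin m → ℤ, ∏ i, e i ^ v i = 1 ∧ ∑ i, (v i).natAbs ≤ d ∧ ∑ i, w i * v i ≠ 0 := by
  classical
  obtain ⟨i₀, hi₀⟩ := Function.ne_iff.1 hw
  obtain ⟨j₀, hj₀⟩ := h2 i₀
  let u : Fin N → ℤ := fun j => ∑ i, if e i = χ j then w i else 0
  have hu : u j₀ ≠ 0 := by
    have : u j₀ = w i₀ := by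
      simp only [u, hj₀, he.eq_iff]; simp
    rw [this]; exact hi₀
  obtain ⟨a, b, hab, hdeg, hne⟩ := claimA ρ P χ hP d s hs halg u j₀ hu
  let v : Fin m → ℤ := fun i => ∑ j, if e i = χ j then ((a j : ℤ) - b j) else 0
  refine ⟨v, ?_, ?_, ?_⟩
  · exact prod_id e χ he h1 a b hab
  · have e1 : ∀ i, (v i).natAbs ≤ ∑ j, if e i = χ j then (a j + b j) else 0 := by
      intro i
      refine (Int.natAbs_sum_le _ _).trans (Finset.sum_le_sum fun j _ => ?_)
      split_ifs
      · omega
      · simp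
    refine (Finset.sum_le_sum fun i _ => e1 i).trans ?_
    rw [Finset.sum_comm]
    refine le_trans (Finset.sum_le_sum (g := fun j => a j + b j) fun j _ => ?_) (by rw [Finset.sum_add_distrib]; exact hdeg)
    by_cases hj : ∃ i, e i = χ j
    · obtain ⟨i, hi⟩ := hj
      rw [← hi]; simp [he.eq_iff]
    · push Not at hj
      simp [hj]
  · have : ∑ i, w i * v i = ∑ j, u j * a j - ∑ j, u j * b j := by
      rw [← Finset.sum_sub_distrib]
      simp only [v, u, Finset.mul_sum, Finset.sum_mul, ← Finset.sum_sub_distrib]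
      rw [Finset.sum_comm]
      refine Finset.sum_congr rfl fun j _ => Finset.sum_congr rfl fun i _ => ?_
      split_ifs
      · ring
      · simp
    rw [this]; exact sub_ne_zero.2 hne

lemma occ_iff {k K : Type} [Field k] [Field K] [Algebra k K] {N : ℕ} {G : Type} [CommGroup G]
    (ρ : G →* GL (Fin N) k) (P : GL (Fin N) K) (χ : Fin N → (G →* Kˣ))
    (hP : ∀ g, ((ρ g : Matrix (Fin N) (Fin N) k).map (algebraMap k K)) * P =
      P * Matrix.diagonal (fun j => (χ j g : K))) (ψ : G →* Kˣ) :
    Occurs (fun g => ρ g) ψ ↔ ∃ j, χ j = ψ := by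
  constructor
  · rintro ⟨v, hv, h⟩
    let y := ((P⁻¹ : GL (Fin N) K) : Matrix (Fin N) (Fin N) K).mulVec v
    have hy : (P : Matrix (Fin N) (Fin N) K).mulVec y = v := by
      simp only [y]
      rw [Matrix.mulVec_mulVec, Units.mul_inv, Matrix.one_mulVec]
    have hy0 : y ≠ 0 := by
      intro h0; rw [h0, Matrix.mulVec_zero] at hy; exact hv hy.symm
    obtain ⟨j, hj⟩ := Function.ne_iff.1 hy0
    refine ⟨j, ?_⟩
    ext g
    have e1 := h g
    have e2 : (P : Matrix (Fin N) (Fin N) K).mulVec ((Matrix.diagonal (fun j => (χ j g : K))).mulVec y) =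
        (P : Matrix (Fin N) (Fin N) K).mulVec ((ψ g : K) • y) := by
      rw [Matrix.mulVec_mulVec, ← hP, ← Matrix.mulVec_mulVec, hy, e1, Matrix.mulVec_smul, hy]
    have e3 := congrArg (((P⁻¹ : GL (Fin N) K) : Matrix (Fin N) (Fin N) K).mulVec) e2
    have hinv : ∀ z, ((P⁻¹ : GL (Fin N) K) : Matrix (Fin N) (Fin N) K).mulVec ((P : Matrix (Fin N) (Fin N) K).mulVec z) = z := by
      intro z; rw [Matrix.mulVec_mulVec, Units.inv_mul, Matrix.one_mulVec]
    rw [hinv, hinv] at e3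
    have e4 := congrFun e3 j
    rw [Matrix.mulVec_diagonal] at e4
    exact mul_right_cancel₀ hj e4
  · rintro ⟨j, rfl⟩
    refine ⟨(P : Matrix (Fin N) (Fin N) K).mulVec (Pi.single j 1), ?_, fun g => ?_⟩
    · intro h0
      have := congrArg (((P⁻¹ : GL (Fin N) K) : Matrix (Fin N) (Fin N) K).mulVec) h0
      rw [Matrix.mulVec_mulVec, Units.inv_mul, Matrix.one_mulVec, Matrix.mulVec_zero] at this
      have := congrFun this j
      simp at this
    · rw [Matrix.mulVec_mulVec, hP, ← Matrix.mulVec_mulVec, ← Matrix.mulVec_smul]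
      congr 1
      ext l
      rw [Matrix.mulVec_diagonal]
      rcases eq_or_ne l j with rfl | h <;> simp [*]

lemma occ_conj {k K : Type} [Field k] [Field K] [Algebra k K] {N : ℕ} {G : Type} [CommGroup G]
    (ρ : G →* GL (Fin N) k) (ψ : G →* Kˣ) (σ : K ≃ₐ[k] K) (h : Occurs (fun g => ρ g) ψ) :
    Occurs (fun g => ρ g) ((Units.map (σ : K →* K)).comp ψ) := by
  obtain ⟨v, hv, h⟩ := h
  refine ⟨fun i => σ (v i), ?_, fun g => ?_⟩
  · intro h0
    apply hv
    ext i
    have := congrFun h0 i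
    simpa using this
  · ext i
    have := congrArg σ (congrFun (h g) i)
    simpa [Matrix.mulVec, dotProduct, map_sum, map_mul] using this

lemma gen_surj {k K : Type} [Field k] [Field K] [Algebra k K] [IsAlgClosed K] {N : ℕ} {G : Type}
    [CommGroup G] [Fintype G] (hchar : (Fintype.card G : K) ≠ 0)
    (ρ : G →* GL (Fin N) k) (hfaithful : Function.Injective ρ) (P : GL (Fin N) K) (χ : Fin N → (G →* Kˣ))
    (hP : ∀ g, ((ρ g : Matrix (Fin N) (Fin N) k).map (algebraMap k K)) * P =
      P * Matrix.diagonal (fun j => (χ j g : K)))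
    {m : ℕ} (e : Fin m → (G →* Kˣ)) 
    (h1 : ∀ j, χ j ≠ 1 → ∃ i, e i = χ j) (ψ : G →* Kˣ) : ∃ c : Fin m → ℤ, ∏ i, e i ^ c i = ψ := by
  classical
  have hNZ : NeZero ((Monoid.exponent G : ℕ) : K) := ⟨fun h => hchar (by
    obtain ⟨c, hc⟩ := Group.exponent_dvd_card (G := G)
    rw [hc]; push_cast; rw [h, zero_mul])⟩
  have hM : HasEnoughRootsOfUnity K (Monoid.exponent G) := inferInstance
  have hM2 : HasEnoughRootsOfUnity K (Monoid.exponent (G →* Kˣ)) := by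
    rwa [Monoid.exponent_eq_of_mulEquiv (CommGroup.monoidHom_mulEquiv_of_hasEnoughRootsOfUnity G K).some]
  have hcd := CommGroup.card_monoidHom_of_hasEnoughRootsOfUnity G K
  have : Finite (G →* Kˣ) := Nat.finite_of_card_ne_zero (by rw [hcd]; exact Nat.card_pos.ne')
  change ψ ∈ genSub e
  rw [← CommGroup.forall_monoidHom_apply_eq_one_iff K (genSub e) ψ]
  intro φ hφ
  let g := CommGroup.monoidHomMonoidHomEquiv G K φ
  have hg : ∀ χ : G →* Kˣ, χ g = φ χ := fun χ => CommGroup.apply_monoidHomMonoidHomEquiv K χ φ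
  have hχ : ∀ j, χ j g = 1 := by
    intro j
    by_cases hj : χ j = 1
    · rw [hj]; rfl
    · obtain ⟨i, hi⟩ := h1 j hj
      rw [hg, ← hi]; exact hφ _ (mem_genSub e i)
  have hg1 : g = 1 := by
    apply hfaithful
    rw [map_one]
    have := hP g
    simp only [hχ, Units.val_one] at this
    rw [show Matrix.diagonal (fun _ : Fin N => (1 : K)) = 1 from Matrix.diagonal_one, mul_one] at this
    have h2 := congrArg (· * ((P⁻¹ : GL (Fin N) K) : Matrix (Fin N) (Fin N) K)) this
    simp only [mul_assoc, Units.mul_inv, mul_one] at h2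
    ext i j
    have h3 := congrFun (congrFun h2 i) j
    rw [Matrix.map_apply] at h3
    apply (algebraMap k K).injective
    rw [h3, Units.val_one, Matrix.one_apply, Matrix.one_apply]
    split_ifs <;> simp
  rw [← hg, hg1, map_one]

lemma card_of_basis {A : Type*} [CommGroup A] {m d : ℕ} [NeZero d] (e : Fin m → A)
    (hsurj : ∀ a : A, ∃ c : Fin m → ℤ, ∏ i, e i ^ c i = a) (hcard : Nat.card A = d ^ m)
    (hpow : ∀ j, e j ^ d = 1) :
    ∃ Ψ : Multiplicative (Fin m → ZMod d) ≃* A,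
      ∀ c : Fin m → ZMod d, Ψ (Multiplicative.ofAdd c) = ∏ i, e i ^ (c i).val := by
  classical
  let Ψ : Multiplicative (Fin m → ZMod d) →* A :=
    { toFun := fun c => ∏ i, e i ^ (c.toAdd i).val
      map_one' := by simp
      map_mul' := fun a b => by
        rw [← Finset.prod_mul_distrib]
        refine Finset.prod_congr rfl fun i _ => ?_
        rw [toAdd_mul, Pi.add_apply, ZMod.val_add, ← pow_eq_pow_mod _ (hpow i), pow_add] }
  have hs : Function.Surjective Ψ := by
    intro a
    obtain ⟨c, rfl⟩ := hsurj a
    refine ⟨Multiplicative.ofAdd fun i => (c i : ZMod d), ?_⟩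
    change ∏ i, e i ^ ((c i : ZMod d)).val = ∏ i, e i ^ c i
    refine Finset.prod_congr rfl fun i _ => ?_
    rw [← zpow_natCast, ZMod.val_intCast]
    exact (zpow_eq_zpow_emod' (c i) (hpow i)).symm
  have hb : Function.Bijective Ψ := by
    have : Finite A := Nat.finite_of_card_ne_zero (by rw [hcard]; exact pow_ne_zero _ (NeZero.ne d))
    refine hs.bijective_of_nat_card_le ?_
    rw [hcard, Nat.card_congr Multiplicative.toAdd]
    simp
  exact ⟨MulEquiv.ofBijective Ψ hb, fun c => rfl⟩

lemma roots_in_k {k K : Type} [Field k] [Field K] [Algebra k K] [IsAlgClosed K] [Normal k K] {N : ℕ} {G : Type}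
    [CommGroup G] (ρ : G →* GL (Fin N) k) {m d : ℕ} [NeZero d] (hdK : (d : K) ≠ 0) (hm : 0 < m)
    (e : Fin m → (G →* Kˣ))
    (hrange : Set.range e = {χ : G →* Kˣ | χ ≠ 1 ∧ Occurs (fun g => ρ g) χ})
    (hpow : ∀ j, e j ^ d = 1)
    (huniq : Function.Injective fun c : Fin m → ZMod d => ∏ i, e i ^ (c i).val) :
    ∃ S : Finset k, S.card = d ∧ ∀ ζ ∈ S, ζ ^ d = 1 := by
  classical
  have : NeZero (d : K) := ⟨hdK⟩
  obtain ⟨ζ, hζ⟩ := HasEnoughRootsOfUnity.exists_primitiveRoot K d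
  have hin : ∃ z : k, algebraMap k K z = ζ := by
    by_contra hnot
    have hint : IsIntegral k ζ := Normal.isIntegral inferInstance ζ
    have hdeg : (minpoly k ζ).natDegree ≠ 1 := by
      intro h
      exact hnot (minpoly.natDegree_eq_one_iff.1 h)
    have hdk : (d : k) ≠ 0 := by
      intro h; apply hdK; rw [← map_natCast (algebraMap k K), h, map_zero]
    have hsep : (minpoly k ζ).Separable := by
      have h1 : (Polynomial.X ^ d - 1 : Polynomial k).Separable := (Polynomial.X_pow_sub_one_separable_iff).2 hdk
      refine h1.of_dvd (minpoly.dvd k ζ ?_)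
      simp [hζ.pow_eq_one]
    have hsplit : ((minpoly k ζ).map (algebraMap k K)).Splits := IsAlgClosed.splits _
    have hcardr : ((minpoly k ζ).aroots K).card = (minpoly k ζ).natDegree := by
      rw [Polynomial.aroots, ← hsplit.natDegree_eq_card_roots, Polynomial.natDegree_map]
    have hnd : ((minpoly k ζ).aroots K).Nodup := Polynomial.nodup_roots hsep.map
    have hpos := minpoly.natDegree_pos hint
    obtain ⟨y, hy, hyne⟩ : ∃ y ∈ (minpoly k ζ).aroots K, y ≠ ζ := by
      by_contra! hall
      have : (minpoly k ζ).aroots K ≤ {ζ} := by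
        rw [Multiset.le_iff_subset hnd]
        intro y hy; simpa using hall y hy
      have := Multiset.card_le_card this
      simp only [Multiset.card_singleton] at this
      omega
    have hyr : Polynomial.aeval y (minpoly k ζ) = 0 := (Polynomial.mem_aroots.1 hy).2
    obtain ⟨σ, hσ⟩ := minpoly.exists_algEquiv_of_root' hint.isAlgebraic hyr
    have hσd : (σ ζ) ^ d = 1 := by rw [← map_pow, hζ.pow_eq_one, map_one]
    obtain ⟨c, hcd, hc⟩ := hζ.eq_pow_of_pow_eq_one hσd
    let i : Fin m := ⟨0, hm⟩
    have hconj : (Units.map (σ : K →* K)).comp (e i) = e i ^ c := by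
      ext g
      have hg : ((e i g : Kˣ) : K) ^ d = 1 := by
        have := DFunLike.congr_fun (hpow i) g
        rw [MonoidHom.pow_apply] at this
        rw [← Units.val_pow_eq_pow_val, this]; rfl
      obtain ⟨r, -, hr⟩ := hζ.eq_pow_of_pow_eq_one hg
      simp only [MonoidHom.comp_apply, Units.coe_map, MonoidHom.pow_apply, Units.val_pow_eq_pow_val, ← hr]
      change σ (ζ ^ r) = _
      rw [map_pow, ← hc, ← pow_mul, ← pow_mul, mul_comm]
    have hi : e i ≠ 1 ∧ Occurs (fun g => ρ g) (e i) := by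
      have : e i ∈ Set.range e := ⟨i, rfl⟩
      rw [hrange] at this; exact this
    have hmem : e i ^ c ∈ Set.range e := by
      rw [hrange, ← hconj]
      refine ⟨fun h => hi.1 ?_, occ_conj ρ _ σ hi.2⟩
      ext g
      have := congrArg Units.val (DFunLike.congr_fun h g)
      simpa using this
    obtain ⟨j, hj⟩ := hmem
    have hd1 : d ≠ 1 := by
      rintro rfl
      apply hnot
      exact ⟨1, by rw [map_one]; simpa using hζ.pow_eq_one.symm⟩
    have hd2 : 1 < d := by have := NeZero.ne d; omega
    have heq : (Pi.single i (c : ZMod d) : Fin m → ZMod d) = Pi.single j ((1 : ℕ) : ZMod d) := by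
      apply huniq
      exact (prod_single e i c hcd).trans (hj.symm.trans ((pow_one (e j)).symm.trans (prod_single e j 1 hd2).symm))
    have hv := congrFun heq j
    rw [Pi.single_eq_same] at hv
    have hji : j = i := by
      by_contra hne
      rw [Pi.single_eq_of_ne hne] at hv
      have := congrArg ZMod.val hv
      rw [ZMod.val_natCast_of_lt hd2] at this
      simp at this
    rw [hji, Pi.single_eq_same] at hv
    have := congrArg ZMod.val hv
    rw [ZMod.val_natCast_of_lt hd2, ZMod.val_natCast_of_lt hcd] at this
    rw [this, pow_one] at hc
    exact hyne (hσ.symm.trans hc.symm)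
  obtain ⟨z, hz⟩ := hin
  have hzp : IsPrimitiveRoot z d := IsPrimitiveRoot.of_map_of_injective (f := algebraMap k K) (by rw [hz]; exact hζ) (algebraMap k K).injective
  refine ⟨Polynomial.nthRootsFinset d (1 : k), hzp.card_nthRootsFinset, fun x hx => ?_⟩
  exact (Polynomial.mem_nthRootsFinset (NeZero.pos d) (1 : k)).1 hx

lemma gamma_le_one {k : Type} [Field k] {N : ℕ} {G : Type} [CommGroup G] [Subsingleton G]
    (ρ : G →* GL (Fin N) k) : gammaR (fun g => ρ g) ≤ 1 := by
  classical
  refine Nat.sInf_le ?_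
  have hinj := IsFractionRing.injective (MvPolynomial (Fin N) k) (FractionRing (MvPolynomial (Fin N) k))
  refine ⟨Set.range fun i : Fin N => algebraMap _ (FractionRing (MvPolynomial (Fin N) k)) (X i : MvPolynomial (Fin N) k), ?_, ?_, ?_⟩
  · rintro _ ⟨i, rfl⟩
    refine ⟨fun g => ?_, X i, 1, one_ne_zero, fun p _ h => isUnit_of_dvd_one h, by simp, by simp⟩
    rw [Subsingleton.elim g 1]
    simp only [map_one]
    exact fAct_one _
  · refine AlgebraicIndependent.to_subtype_range (x := fun i : Fin N => algebraMap _ (FractionRing (MvPolynomial (Fin N) k)) (X i : MvPolynomial (Fin N) k)) ?_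
    have := (MvPolynomial.algebraicIndependent_X (Fin N) k).map' (f := IsScalarTower.toAlgHom k (MvPolynomial (Fin N) k) (FractionRing (MvPolynomial (Fin N) k))) hinj
    exact this
  · intro f _
    have hp : ∀ p : MvPolynomial (Fin N) k, algebraMap _ (FractionRing (MvPolynomial (Fin N) k)) p ∈
        IntermediateField.adjoin k (Set.range fun i : Fin N => algebraMap _ (FractionRing (MvPolynomial (Fin N) k)) (X i : MvPolynomial (Fin N) k)) := by
      intro p
      induction p using MvPolynomial.induction_on with
      | C a =>
        rw [← algebraMap_eq, ← IsScalarTower.algebraMap_apply]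
        exact IntermediateField.algebraMap_mem _ a
      | add p q hp hq => rw [map_add]; exact add_mem hp hq
      | mul_X p i hp => rw [map_mul]; exact mul_mem hp (IntermediateField.subset_adjoin _ _ ⟨i, rfl⟩)
    obtain ⟨a, b, -, rfl⟩ := IsFractionRing.div_surjective (A := MvPolynomial (Fin N) k) f
    exact isAlgebraic_algebraMap (⟨_, div_mem (hp a) (hp b)⟩ : IntermediateField.adjoin k _)

/-- Characterization of the equality case in the sharp lower bound: if
`γ^r(G,V)^m = |G|`, then, with `d := γ^r(G,V)`, the field `k` contains `d` distinct `d`-th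
roots of unity, `G ≅ (ℤ/dℤ)^m`, and the `m` distinct nontrivial characters occurring in the
base change of `V` to the algebraic closure form a basis of the character group of `G` as a
`ℤ/dℤ`-module (every character is uniquely a product of powers of them with exponents in
`ℤ/dℤ`). -/
theorem stmt12 {k : Type} [Field k] {N : ℕ} {G : Type} [CommGroup G] [Fintype G]
    (hchar : (Fintype.card G : k) ≠ 0) (ρ : G →* GL (Fin N) k)
    (hfaithful : Function.Injective ρ) (m : ℕ)
    (hm : {χ : G →* (AlgebraicClosure k)ˣ | χ ≠ 1 ∧ Occurs (fun g => ρ g) χ}.ncard = m)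
    (heq : gammaR (fun g => ρ g) ^ m = Fintype.card G) :
    (∃ S : Finset k, S.card = gammaR (fun g => ρ g) ∧
        ∀ ζ ∈ S, ζ ^ gammaR (fun g => ρ g) = 1) ∧
    Nonempty (G ≃* Multiplicative (Fin m → ZMod (gammaR (fun g => ρ g)))) ∧
    ∃ e : Fin m → (G →* (AlgebraicClosure k)ˣ),
      Function.Injective e ∧
      Set.range e = {χ : G →* (AlgebraicClosure k)ˣ | χ ≠ 1 ∧ Occurs (fun g => ρ g) χ} ∧
      ∀ ψ : G →* (AlgebraicClosure k)ˣ,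
        ∃! c : Fin m → ZMod (gammaR (fun g => ρ g)), ψ = ∏ i, e i ^ (c i).val := by
  classical
  rcases Nat.eq_zero_or_pos m with rfl | hmpos
  · rw [pow_zero] at heq
    have hsub : Subsingleton G := Fintype.card_le_one_iff_subsingleton.1 heq.symm.le
    have hle := gamma_le_one ρ
    refine ⟨?_, ?_, ?_⟩
    · rcases Nat.le_one_iff_eq_zero_or_eq_one.1 hle with h | h
      · rw [h]; exact ⟨∅, by simp, by simp⟩
      · rw [h]; exact ⟨{1}, by simp, by simp⟩
    · have : Unique G := ⟨⟨1⟩, fun a => Subsingleton.elim _ _⟩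
      have : Subsingleton (Multiplicative (Fin 0 → ZMod (gammaR (fun g => ρ g)))) :=
        inferInstanceAs (Subsingleton (Fin 0 → ZMod (gammaR (fun g => ρ g))))
      exact ⟨⟨⟨fun _ => 1, fun _ => 1, fun _ => Subsingleton.elim _ _,
        fun _ => Subsingleton.elim _ _⟩, fun _ _ => Subsingleton.elim _ _⟩⟩
    · have hone : ∀ ψ : G →* (AlgebraicClosure k)ˣ, ψ = 1 := by
        intro ψ
        ext g
        rw [Subsingleton.elim g 1]; simp
      refine ⟨fun i => i.elim0, fun i => i.elim0, ?_, fun ψ => ⟨fun i => i.elim0, ?_, ?_⟩⟩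
      · ext ψ
        simp [hone ψ]
      · simp [hone ψ]
      · intro c _
        exact Subsingleton.elim _ _
  · have hcK : (Fintype.card G : AlgebraicClosure k) ≠ 0 := by
      intro h; apply hchar
      apply (algebraMap k (AlgebraicClosure k)).injective
      rw [map_natCast, h, map_zero]
    have hd0 : gammaR (fun g => ρ g) ≠ 0 := by
      intro h
      rw [h, zero_pow hmpos.ne'] at heq
      exact Fintype.card_ne_zero heq.symm
    obtain ⟨s, hs, -, halg⟩ := Nat.sInf_mem (Nat.nonempty_of_pos_sInf (Nat.pos_of_ne_zero hd0))
    change ∀ f ∈ s, IsInv (fun g => ρ g) f ∧ RDegLE f (gammaR (fun g => ρ g)) at hs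
    generalize gammaR (fun g => ρ g) = d at *
    have : NeZero d := ⟨hd0⟩
    obtain ⟨P, χ, hP⟩ := exists_diag hcK
      ((Matrix.GeneralLinearGroup.map (algebraMap k (AlgebraicClosure k))).comp ρ)
    have hP : ∀ g, ((ρ g : Matrix (Fin N) (Fin N) k).map (algebraMap k (AlgebraicClosure k))) * P =
      P * Matrix.diagonal (fun j => (χ j g : AlgebraicClosure k)) := hP
    have hNZ : NeZero ((Monoid.exponent G : ℕ) : AlgebraicClosure k) := ⟨fun h => hcK (by
      obtain ⟨c, hc⟩ := Group.exponent_dvd_card (G := G)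
      rw [hc]; push_cast; rw [h, zero_mul])⟩
    have hcd := CommGroup.card_monoidHom_of_hasEnoughRootsOfUnity G (AlgebraicClosure k)
    have : Finite (G →* (AlgebraicClosure k)ˣ) :=
      Nat.finite_of_card_ne_zero (by rw [hcd]; exact Nat.card_pos.ne')
    have hcard : Nat.card (G →* (AlgebraicClosure k)ˣ) = d ^ m := by
      rw [hcd, Nat.card_eq_fintype_card, heq]
    have hE : Nat.card {χ : G →* (AlgebraicClosure k)ˣ | χ ≠ 1 ∧ Occurs (fun g => ρ g) χ} = m := hm
    let ee := (Finite.equivFinOfCardEq hE).symm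
    let e : Fin m → (G →* (AlgebraicClosure k)ˣ) := fun i => (ee i).1
    have heinj : Function.Injective e := Subtype.val_injective.comp ee.injective
    have herange : Set.range e = {χ : G →* (AlgebraicClosure k)ˣ | χ ≠ 1 ∧ Occurs (fun g => ρ g) χ} := by
      ext ψ
      constructor
      · rintro ⟨i, rfl⟩; exact (ee i).2
      · intro h; exact ⟨ee.symm ⟨ψ, h⟩, by simp [e]⟩
    have h1 : ∀ j, χ j ≠ 1 → ∃ i, e i = χ j := by
      intro j hj
      have : χ j ∈ Set.range e := by
        rw [herange]; exact ⟨hj, (occ_iff ρ P χ hP _).2 ⟨j, rfl⟩⟩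
      exact this
    have h2 : ∀ i, ∃ j, χ j = e i := fun i => (occ_iff ρ P χ hP _).1 (ee i).2.2
    have hsurj := gen_surj hcK ρ hfaithful P χ hP e h1
    have hpow := lattice_main (Nat.pos_of_ne_zero hd0) e hsurj hcard
      (fun w hw => claimB ρ P χ hP d s hs halg e heinj h1 h2 w hw)
    obtain ⟨Ψ, hΨ⟩ := card_of_basis e hsurj hcard hpow
    refine ⟨?_, ?_, e, heinj, herange, fun ψ => ?_⟩
    · refine roots_in_k (K := AlgebraicClosure k) ρ ?_ hmpos e herange hpow ?_
      · intro h; apply hcK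
        rw [← heq]; push_cast; rw [h, zero_pow hmpos.ne']
      · intro a b hab
        simp only [← hΨ] at hab
        exact Ψ.injective hab
    · exact ⟨(CommGroup.monoidHom_mulEquiv_of_hasEnoughRootsOfUnity G
        (AlgebraicClosure k)).some.symm.trans Ψ.symm⟩
    · refine ⟨(Ψ.symm ψ).toAdd, ?_, ?_⟩
      · simp only [← hΨ]; simp
      · intro c hc
        rw [← hΨ] at hc
        rw [hc]; simp
end
end
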